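/- In the setting of the main theorem (quaternary (V,φ) over a number field, h with φ[h]=q≠0, W=(Fh)^⊥, ψ=φ|_W, L a g-maximal lattice in V): the class number of the genus of L∩W with respect to SO^ψ(W) equals the type number of the order 𝔬 = A⁺(L∩W), whose discriminant is q[L̃/L](2φ(h,L))⁻². -/

import Mathlib

noncomputable section

namespace Paper

variable (R F : Type*) [CommRing R] [Field F] [Algebra R F]

section Lattices

variable (W : Type*) [AddCommGroup W] [Module F W] [Module R W] [IsScalarTower R F W]

/-- A `g`-lattice in `W`: a finitely generated `R`-submodule containing an `F`-basis. -/
def IsLat (L : Submodule R W) : Prop :=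
  L.FG ∧ Submodule.span F (L : Set W) = ⊤

/-- integral lattice with respect to a bilinear form -/
def IsIntegralLat (ψ : LinearMap.BilinForm F W) (L : Submodule R W) : Prop :=
  IsLat R F W L ∧ ∀ x ∈ L, ψ x x ∈ (algebraMap R F).range

/-- maximal lattice with respect to a bilinear form -/
def IsMaximalLat (ψ : LinearMap.BilinForm F W) (L : Submodule R W) : Prop :=
  IsIntegralLat R F W ψ L ∧ ∀ L' : Submodule R W, IsIntegralLat R F W ψ L' → L ≤ L' → L' = L

/-- the ideal `[L/M]` generated by determinants of `F`-automorphisms carrying `L` into `M` -/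
def latIdx (L M : Submodule R W) : Submodule R F :=
  Submodule.span R {d : F | ∃ α : W ≃ₗ[F] W, (∀ x ∈ L, α x ∈ M) ∧
    LinearMap.det (α : W →ₗ[F] W) = d}

/-- the dual lattice `L~ = {x | 2ψ(x,L) ⊆ g}` -/
def dualLat (ψ : LinearMap.BilinForm F W) (L : Submodule R W) : Submodule R W :=
  ⨅ y ∈ L, Submodule.comap (((2 : F) • (ψ.flip y)).restrictScalars R)
    (LinearMap.range (Algebra.linearMap R F))

/-- the ideal `[L/M]` for lattices spanning the subspace `U`, computed inside `U` -/
def latIdxIn (U : Submodule F W) (L M : Submodule R W) : Submodule R F :=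
  latIdx R F ↥U (Submodule.comap ((U.subtype).restrictScalars R) L)
    (Submodule.comap ((U.subtype).restrictScalars R) M)

/-- product of a fractional ideal and a lattice -/
def idSMul {M : Type*} [AddCommGroup M] [Module F M] [Module R M] [IsScalarTower R F M]
    (I : Submodule R F) (N : Submodule R M) : Submodule R M :=
  Submodule.span R {z : M | ∃ c ∈ I, ∃ x ∈ N, z = c • x}

end Lattices

/-- the fractional ideal attached to an integral ideal -/
def idealToF (I : Ideal R) : Submodule R F :=
  Submodule.map (Algebra.linearMap R F) I

section Clifford

variable (W : Type*) [AddCommGroup W] [Module F W] [Module R W] [IsScalarTower R F W]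
variable (Q : QuadraticForm F W)

/-- the order `A(N)` generated by `g` and `N` in the Clifford algebra -/
def cliffordOrder (N : Submodule R W) : Subalgebra R (CliffordAlgebra Q) :=
  Algebra.adjoin R (CliffordAlgebra.ι Q '' (N : Set W))

/-- the even Clifford algebra, as an `R`-subalgebra -/
def evenR : Subalgebra R (CliffordAlgebra Q) :=
  (CliffordAlgebra.even Q).restrictScalars R

/-- `A⁺(N) = A⁺(W) ∩ A(N)` -/
def APlus (N : Submodule R W) : Subalgebra R (CliffordAlgebra Q) :=
  evenR R F W Q ⊓ cliffordOrder R F W Q N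

def APlusSub (N : Submodule R W) : Submodule R (CliffordAlgebra Q) :=
  Subalgebra.toSubmodule (APlus R F W Q N)

def oneLat : Submodule R (CliffordAlgebra Q) :=
  LinearMap.range (Algebra.linearMap R (CliffordAlgebra Q))

/-- the `R`-linear map `x ↦ 2ν(x,y) = x·y* + y·x*`, where `*` is the canonical
involution (reversal) of the Clifford algebra -/
def traceMap (y : CliffordAlgebra Q) : CliffordAlgebra Q →ₗ[R] CliffordAlgebra Q :=
  ((LinearMap.mulRight F (CliffordAlgebra.reverse (Q := Q) y)) +
    (LinearMap.mulLeft F y) ∘ₗ (CliffordAlgebra.reverse (Q := Q))).restrictScalars R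

/-- the dual `o~ = {x ∈ A⁺(W) | 2ν(x,o) ⊆ g}` with respect to the norm form
`ν[x] = x x*` of the even Clifford algebra -/
def normDual (o : Submodule R (CliffordAlgebra Q)) : Submodule R (CliffordAlgebra Q) :=
  Subalgebra.toSubmodule (evenR R F W Q) ⊓
    ⨅ y ∈ o, Submodule.comap (traceMap R F W Q y) (oneLat R F W Q)

/-- `A⁺(W)° = {x ∈ A⁺(W) | x* = -x}`, as an `R`-submodule -/
def minusPart : Submodule R (CliffordAlgebra Q) :=
  Subalgebra.toSubmodule (evenR R F W Q) ⊓
    LinearMap.ker ((CliffordAlgebra.reverse (Q := Q) + LinearMap.id).restrictScalars R)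

end Clifford

end Paper

namespace Paper

section Orders

variable (R F : Type*) [CommRing R] [Field F] [Algebra R F]
variable (A : Type*) [Ring A] [Algebra F A] [Algebra R A] [IsScalarTower R F A]

/-- an order in the `F`-subalgebra `B` of `A`: an `R`-subalgebra which is an `R`-lattice
in `B` -/
def IsOrderIn (B : Subalgebra F A) (o : Subalgebra R A) : Prop :=
  (Subalgebra.toSubmodule o).FG ∧ (o : Set A) ⊆ (B : Set A) ∧
    Submodule.span F (o : Set A) = Subalgebra.toSubmodule B

/-- a maximal order in `B` -/
def IsMaximalOrderIn (B : Subalgebra F A) (o : Subalgebra R A) : Prop :=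
  IsOrderIn R F A B o ∧ ∀ o' : Subalgebra R A, IsOrderIn R F A B o' → o ≤ o' → o' = o

end Orders

section Abbrev

variable (R F : Type*) [CommRing R] [Field F] [Algebra R F]
variable (W : Type*) [AddCommGroup W] [Module F W] [Module R W] [IsScalarTower R F W]
variable (psi : LinearMap.BilinForm F W)

/-- the ideal `[A⁺(M)/A⁺(N)]`, computed inside the quaternion algebra `A⁺(W)` -/
def APlusIdx (M N : Submodule R W) : Submodule R F :=
  latIdxIn R F (CliffordAlgebra (LinearMap.BilinMap.toQuadraticMap psi))
    (Subalgebra.toSubmodule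
      (CliffordAlgebra.even (LinearMap.BilinMap.toQuadraticMap psi)))
    (APlusSub R F W (LinearMap.BilinMap.toQuadraticMap psi) M)
    (APlusSub R F W (LinearMap.BilinMap.toQuadraticMap psi) N)

/-- the ideal `[A⁺(N)~/A⁺(N)]`, computed inside the quaternion algebra `A⁺(W)` -/
def APlusDualIdx (N : Submodule R W) : Submodule R F :=
  latIdxIn R F (CliffordAlgebra (LinearMap.BilinMap.toQuadraticMap psi))
    (Subalgebra.toSubmodule
      (CliffordAlgebra.even (LinearMap.BilinMap.toQuadraticMap psi)))
    (normDual R F W (LinearMap.BilinMap.toQuadraticMap psi)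
      (APlusSub R F W (LinearMap.BilinMap.toQuadraticMap psi) N))
    (APlusSub R F W (LinearMap.BilinMap.toQuadraticMap psi) N)

/-- the fractional ideal `2⁻¹·[Ñ/N]` -/
def halfDualIdx (N : Submodule R W) : Submodule R F :=
  Submodule.span R {((2 : F)⁻¹)} * latIdx R F W (dualLat R F W psi N) N

end Abbrev

end Paper

namespace Paper

section SOConj

variable (R F : Type*) [CommRing R] [Field F] [Algebra R F]
variable (W : Type*) [AddCommGroup W] [Module F W] [Module R W] [IsScalarTower R F W]

/-- membership in the special orthogonal group `SO^ψ` -/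
def IsSOElem (ψ : LinearMap.BilinForm F W) (γ : W ≃ₗ[F] W) : Prop :=
  (∀ x y, ψ (γ x) (γ y) = ψ x y) ∧ LinearMap.det (γ : W →ₗ[F] W) = 1

/-- the (right) action of `γ` on lattices -/
def latAction (γ : W ≃ₗ[F] W) (N : Submodule R W) : Submodule R W :=
  Submodule.map ((γ : W →ₗ[F] W).restrictScalars R) N

variable (Q : QuadraticForm F W)

/-- a unit of the even Clifford algebra `A⁺(W)`, i.e. of the even Clifford group
`G⁺(W)` (for ternary spaces `G⁺(W) = A⁺(W)ˣ`) -/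
def IsGPlusUnit (α : (CliffordAlgebra Q)ˣ) : Prop :=
  ((α : CliffordAlgebra Q) ∈ CliffordAlgebra.even Q) ∧
    (((α⁻¹ : (CliffordAlgebra Q)ˣ) : CliffordAlgebra Q) ∈ CliffordAlgebra.even Q)

/-- conjugation `x ↦ α⁻¹ x α` as an `R`-linear map -/
def conjMap (α : (CliffordAlgebra Q)ˣ) : CliffordAlgebra Q →ₗ[R] CliffordAlgebra Q :=
  ((LinearMap.mulLeft F (((α⁻¹ : (CliffordAlgebra Q)ˣ) : CliffordAlgebra Q))).comp
    (LinearMap.mulRight F (α : CliffordAlgebra Q))).restrictScalars R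

/-- `γ = τ(α)`: the automorphism `γ` of `W` is induced by conjugation by `α` via the
homomorphism `τ : G⁺(W) → SO^ψ`, `x·τ(α) = α⁻¹ x α`. -/
def IsTau (γ : W ≃ₗ[F] W) (α : (CliffordAlgebra Q)ˣ) : Prop :=
  ∀ x : W, CliffordAlgebra.ι Q (γ x) =
    ((α⁻¹ : (CliffordAlgebra Q)ˣ) : CliffordAlgebra Q) * CliffordAlgebra.ι Q x *
      (α : CliffordAlgebra Q)

end SOConj

section Genus

open IsDedekindDomain

variable (R F : Type*) [CommRing R] [IsDedekindDomain R] [Field F] [Algebra R F]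
variable (W : Type*) [AddCommGroup W] [Module F W] [Module R W] [IsScalarTower R F W]

/-- the localization `N_(v)` of an `R`-submodule `N` at a finite prime `v`,
taken inside the ambient vector space -/
def localAt (v : HeightOneSpectrum R) (N : Submodule R W) : Submodule R W where
  carrier := {x | ∃ s : R, s ∉ v.asIdeal ∧ s • x ∈ N}
  zero_mem' := ⟨1, fun hmem =>
    v.isPrime.ne_top (Ideal.eq_top_of_isUnit_mem _ hmem isUnit_one), by
      simp⟩
  add_mem' := by
    rintro x y ⟨s, hs, hsx⟩ ⟨t, ht, hty⟩
    refine ⟨s * t, fun hmem => ?_, ?_⟩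
    · rcases v.isPrime.mem_or_mem hmem with hmem | hmem
      exacts [hs hmem, ht hmem]
    · have hx' : (s * t) • x ∈ N := by
        rw [mul_comm, mul_smul]; exact N.smul_mem t hsx
      have hy' : (s * t) • y ∈ N := by
        rw [mul_smul]; exact N.smul_mem s hty
      simpa [smul_add] using N.add_mem hx' hy'
  smul_mem' := by
    rintro r x ⟨s, hs, hsx⟩
    exact ⟨s, hs, by rw [smul_comm]; exact N.smul_mem r hsx⟩

/-- `N` belongs to the `SO^ψ`-genus of `L0`: at every finite prime the localizations
are carried into each other by an element of the special orthogonal group. -/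
def InGenus (ψ : LinearMap.BilinForm F W) (L0 N : Submodule R W) : Prop :=
  ∀ v : HeightOneSpectrum R, ∃ γ : W ≃ₗ[F] W, IsSOElem F W ψ γ ∧
    latAction R F W γ (localAt R W v N) = localAt R W v L0

variable (Q : QuadraticForm F W)

/-- `o` belongs to the genus `{β⁻¹ o0 β | β ∈ A⁺(W)ˣ_𝐀}` of the order `o0` -/
def OrderInGenus (o0 o : Submodule R (CliffordAlgebra Q)) : Prop :=
  ∀ v : HeightOneSpectrum R, ∃ α : (CliffordAlgebra Q)ˣ, IsGPlusUnit F W Q α ∧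
    Submodule.map (conjMap R F W Q α) (localAt R (CliffordAlgebra Q) v o0) =
      localAt R (CliffordAlgebra Q) v o

end Genus

end Paper

namespace Paper

set_option linter.unusedSectionVars false

open IsDedekindDomain Module

section Localization

variable (R F : Type*) [CommRing R] [IsDedekindDomain R] [Field F] [Algebra R F]

/-- The localization of `R` at a finite prime `v`, as a subalgebra of `F`. -/
def locRing (v : HeightOneSpectrum R) : Subalgebra R F where
  carrier := {x | ∃ s : R, s ∉ v.asIdeal ∧ s • x ∈ (algebraMap R F).range}
  mul_mem' := by
    rintro x y ⟨s, hs, a, ha⟩ ⟨t, ht, b, hb⟩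
    refine ⟨s * t, fun hst => (v.isPrime.mem_or_mem hst).elim hs ht, a * b, ?_⟩
    rw [map_mul, ha, hb, smul_mul_smul_comm]
  add_mem' := by
    rintro x y ⟨s, hs, a, ha⟩ ⟨t, ht, b, hb⟩
    refine ⟨s * t, fun hst => (v.isPrime.mem_or_mem hst).elim hs ht, t * a + s * b, ?_⟩
    rw [map_add, map_mul, map_mul, ha, hb]
    simp only [Algebra.smul_def, map_mul]
    ring
  algebraMap_mem' r := ⟨1, fun h1 => v.isPrime.ne_top ((Ideal.eq_top_iff_one _).2 h1), r, by simp⟩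

variable {R F}

theorem mem_locRing {v : HeightOneSpectrum R} {x : F} :
    x ∈ locRing R F v ↔ ∃ s : R, s ∉ v.asIdeal ∧ s • x ∈ (algebraMap R F).range := Iff.rfl

theorem one_notMem_asIdeal (v : HeightOneSpectrum R) : (1 : R) ∉ v.asIdeal :=
  fun h1 => v.isPrime.ne_top ((Ideal.eq_top_iff_one _).2 h1)

theorem mul_notMem_asIdeal {v : HeightOneSpectrum R} {s t : R} (hs : s ∉ v.asIdeal)
    (ht : t ∉ v.asIdeal) : s * t ∉ v.asIdeal :=
  fun hst => (v.isPrime.mem_or_mem hst).elim hs ht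

theorem pow_notMem_asIdeal {v : HeightOneSpectrum R} {s : R} (hs : s ∉ v.asIdeal) (n : ℕ) :
    s ^ n ∉ v.asIdeal :=
  fun h => hs (v.isPrime.mem_of_pow_mem n h)

theorem prod_notMem_asIdeal {v : HeightOneSpectrum R} {ι : Type*} {t : Finset ι} {s : ι → R}
    (hs : ∀ i ∈ t, s i ∉ v.asIdeal) : ∏ i ∈ t, s i ∉ v.asIdeal := by
  intro h
  obtain ⟨i, hi, h⟩ := (Ideal.IsPrime.prod_mem_iff (hp := v.isPrime)).1 h
  exact hs i hi h

theorem ne_zero_of_notMem_asIdeal {v : HeightOneSpectrum R} {s : R} (hs : s ∉ v.asIdeal) :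
    s ≠ 0 := fun h => hs (h ▸ v.asIdeal.zero_mem)

variable [IsFractionRing R F]

theorem algebraMap_ne_zero_of_notMem_asIdeal {v : HeightOneSpectrum R} {s : R}
    (hs : s ∉ v.asIdeal) : algebraMap R F s ≠ 0 :=
  fun h => ne_zero_of_notMem_asIdeal hs ((IsFractionRing.to_map_eq_zero_iff).1 h)

theorem inv_mem_locRing {v : HeightOneSpectrum R} {s : R} (hs : s ∉ v.asIdeal) :
    (algebraMap R F s)⁻¹ ∈ locRing R F v :=
  ⟨s, hs, 1, by
    rw [Algebra.smul_def, map_one, mul_inv_cancel₀ (algebraMap_ne_zero_of_notMem_asIdeal hs)]⟩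

theorem locRing_eq_ofField (v : HeightOneSpectrum R) :
    locRing R F v = Localization.subalgebra.ofField F v.asIdeal.primeCompl
      v.asIdeal.primeCompl_le_nonZeroDivisors := by
  ext x
  constructor
  · rintro ⟨s, hs, a, ha⟩
    refine ⟨a, s, hs, ?_⟩
    rw [ha, Algebra.smul_def]
    have := algebraMap_ne_zero_of_notMem_asIdeal (F := F) hs
    field_simp
  · rintro ⟨a, s, hs, rfl⟩
    exact mul_mem ((locRing R F v).algebraMap_mem a) (inv_mem_locRing hs)

instance (v : HeightOneSpectrum R) : IsLocalization.AtPrime (locRing R F v) v.asIdeal := by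
  rw [locRing_eq_ofField]
  exact Localization.subalgebra.isLocalization_ofField F _ _

instance (v : HeightOneSpectrum R) : IsDiscreteValuationRing (locRing R F v) :=
  IsLocalization.AtPrime.isDiscreteValuationRing_of_dedekind_domain R v.ne_bot _

variable {U : Type*} [AddCommGroup U] [Module F U] [Module R U] [IsScalarTower R F U]

theorem mem_localAt {v : HeightOneSpectrum R} {N : Submodule R U} {x : U} :
    x ∈ localAt R U v N ↔ ∃ s : R, s ∉ v.asIdeal ∧ s • x ∈ N := Iff.rfl

theorem le_localAt (v : HeightOneSpectrum R) (N : Submodule R U) : N ≤ localAt R U v N :=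
  fun x hx => ⟨1, one_notMem_asIdeal v, by simpa using hx⟩

theorem localAt_mono (v : HeightOneSpectrum R) {N N' : Submodule R U} (h : N ≤ N') :
    localAt R U v N ≤ localAt R U v N' :=
  fun _ ⟨s, hs, hx⟩ => ⟨s, hs, h hx⟩

theorem localAt_localAt (v : HeightOneSpectrum R) (N : Submodule R U) :
    localAt R U v (localAt R U v N) = localAt R U v N := by
  refine le_antisymm ?_ (le_localAt _ _)
  rintro x ⟨s, hs, t, ht, hx⟩
  exact ⟨t * s, mul_notMem_asIdeal ht hs, by rwa [mul_smul]⟩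

theorem localAt_le_localAt_iff {v : HeightOneSpectrum R} {N N' : Submodule R U} :
    localAt R U v N ≤ localAt R U v N' ↔ N ≤ localAt R U v N' := by
  refine ⟨(le_localAt v N).trans, fun h => ?_⟩
  rw [← localAt_localAt v N']
  exact localAt_mono v h

theorem localAt_inf (v : HeightOneSpectrum R) (N N' : Submodule R U) :
    localAt R U v (N ⊓ N') = localAt R U v N ⊓ localAt R U v N' := by
  refine le_antisymm (le_inf (localAt_mono v inf_le_left) (localAt_mono v inf_le_right)) ?_
  rintro x ⟨⟨s, hs, hx⟩, t, ht, hx'⟩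
  refine ⟨s * t, mul_notMem_asIdeal hs ht, ?_, ?_⟩
  · rw [mul_comm, mul_smul]; exact N.smul_mem t hx
  · rw [mul_smul]; exact N'.smul_mem s hx'

theorem smul_mem_localAt {v : HeightOneSpectrum R} {N : Submodule R U} {c : F} {x : U}
    (hc : c ∈ locRing R F v) (hx : x ∈ localAt R U v N) : c • x ∈ localAt R U v N := by
  obtain ⟨s, hs, a, ha⟩ := hc
  obtain ⟨t, ht, hx⟩ := hx
  refine ⟨t * s, mul_notMem_asIdeal ht hs, ?_⟩
  rw [mul_smul, ← smul_assoc s c x, ← ha, algebraMap_smul, smul_comm]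
  exact N.smul_mem a hx

theorem mem_of_forall_mem_localAt (hR : ¬ IsField R) {N : Submodule R U} {x : U}
    (h : ∀ v : HeightOneSpectrum R, x ∈ localAt R U v N) : x ∈ N := by
  let I : Ideal R := Submodule.comap (LinearMap.toSpanSingleton R U x) N
  suffices hI : I = ⊤ by
    have h1 : (1 : R) ∈ I := hI ▸ Submodule.mem_top
    simpa [I] using h1
  by_contra hI
  obtain ⟨m, hm, hIm⟩ := Ideal.exists_le_maximal I hI
  obtain ⟨s, hs, hx⟩ := h ⟨m, hm.isPrime, Ring.ne_bot_of_isMaximal_of_not_isField hm hR⟩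
  exact hs (hIm (by simpa [I] using hx))

theorem le_of_forall_localAt_le (hR : ¬ IsField R) {N N' : Submodule R U}
    (h : ∀ v : HeightOneSpectrum R, localAt R U v N ≤ localAt R U v N') : N ≤ N' :=
  fun _ hx => mem_of_forall_mem_localAt hR fun v => h v (le_localAt v N hx)

theorem eq_of_forall_localAt_eq (hR : ¬ IsField R) {N N' : Submodule R U}
    (h : ∀ v : HeightOneSpectrum R, localAt R U v N = localAt R U v N') : N = N' :=
  le_antisymm (le_of_forall_localAt_le hR fun v => (h v).le)
    (le_of_forall_localAt_le hR fun v => (h v).ge)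

theorem localAt_map (v : HeightOneSpectrum R) {U' : Type*} [AddCommGroup U'] [Module F U']
    [Module R U'] [IsScalarTower R F U'] (f : U →ₗ[R] U') (N : Submodule R U) :
    localAt R U' v (Submodule.map f N) = Submodule.map f (localAt R U v N) := by
  ext x
  constructor
  · rintro ⟨s, hs, y, hy, hxy⟩
    have hs0 := algebraMap_ne_zero_of_notMem_asIdeal (F := F) hs
    have key : s • f ((algebraMap R F s)⁻¹ • y) = s • x := by
      rw [← map_smul, ← hxy, ← algebraMap_smul F s, smul_smul, mul_inv_cancel₀ hs0, one_smul]
    refine ⟨(algebraMap R F s)⁻¹ • y, smul_mem_localAt (inv_mem_locRing hs) (le_localAt v N hy), ?_⟩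
    rw [← algebraMap_smul F s, ← algebraMap_smul F s] at key
    exact smul_right_injective _ hs0 key
  · rintro ⟨y, ⟨s, hs, hy⟩, rfl⟩
    exact ⟨s, hs, s • y, hy, map_smul f s y⟩

/-- A finite family of elements of a localized module is cleared by one common denominator. -/
theorem exists_smul_mem_of_forall_mem_localAt {v : HeightOneSpectrum R} {N : Submodule R U}
    {ι : Type*} (t : Finset ι) {x : ι → U} (h : ∀ i ∈ t, x i ∈ localAt R U v N) :
    ∃ s : R, s ∉ v.asIdeal ∧ ∀ i ∈ t, s • x i ∈ N := by
  classical
  choose! s hs hx using h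
  refine ⟨∏ i ∈ t, s i, prod_notMem_asIdeal hs, fun i hi => ?_⟩
  rw [← Finset.prod_erase_mul _ _ hi, mul_smul]
  exact N.smul_mem _ (hx i hi)

theorem exists_smul_le_of_fg {v : HeightOneSpectrum R} {N N' : Submodule R U} (hN : N.FG)
    (h : N ≤ localAt R U v N') : ∃ s : R, s ∉ v.asIdeal ∧ ∀ x ∈ N, s • x ∈ N' := by
  obtain ⟨t, rfl⟩ := hN
  obtain ⟨s, hs, hst⟩ := exists_smul_mem_of_forall_mem_localAt t (x := id)
    fun i hi => h (Submodule.subset_span hi)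
  refine ⟨s, hs, fun x hx => ?_⟩
  have : Submodule.span R (t : Set U) ≤ N'.comap (LinearMap.lsmul R U s) :=
    Submodule.span_le.2 fun i hi => hst i hi
  exact this hx

theorem exists_smul_mem_of_mem_span {N : Submodule R U} {x : U}
    (hx : x ∈ Submodule.span F (N : Set U)) : ∃ s : R, s ≠ 0 ∧ s • x ∈ N := by
  induction hx using Submodule.span_induction with
  | mem x hx => exact ⟨1, one_ne_zero, by simpa using hx⟩
  | zero => exact ⟨1, one_ne_zero, by simp⟩
  | add x y _ _ hx hy =>
    obtain ⟨s, hs, hx⟩ := hx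
    obtain ⟨t, ht, hy⟩ := hy
    refine ⟨s * t, mul_ne_zero hs ht, ?_⟩
    rw [smul_add]
    refine N.add_mem ?_ ?_
    · rw [mul_comm, mul_smul]; exact N.smul_mem t hx
    · rw [mul_smul]; exact N.smul_mem s hy
  | smul a x _ hx =>
    obtain ⟨s, hs, hx⟩ := hx
    obtain ⟨r, t, ht, rfl⟩ := IsFractionRing.div_surjective R a
    have ht0 : algebraMap R F t ≠ 0 := IsFractionRing.to_map_ne_zero_of_mem_nonZeroDivisors ht
    refine ⟨t * s, mul_ne_zero (nonZeroDivisors.ne_zero ht) hs, ?_⟩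
    have : (t * s) • (algebraMap R F r / algebraMap R F t) • x = r • s • x := by
      rw [← algebraMap_smul F (t * s), ← algebraMap_smul F r, ← algebraMap_smul F s x, smul_smul,
        smul_smul, map_mul]
      congr 1
      field_simp
    rw [this]
    exact N.smul_mem r hx

end Localization

section Coordinates

variable {R F : Type*} [CommRing R] [Field F] [Algebra R F]
variable {U : Type*} [AddCommGroup U] [Module F U] [Module R U] [IsScalarTower R F U]

/-- The `S`-linear combinations of a finite family `b`. -/
def coordSpan (S : Subalgebra R F) {n : ℕ} (b : Fin n → U) : Submodule R U where
  carrier := {x | ∃ c : Fin n → F, (∀ i, c i ∈ S) ∧ x = ∑ i, c i • b i}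
  zero_mem' := ⟨0, fun _ => S.zero_mem, by simp⟩
  add_mem' := by
    rintro x y ⟨c, hc, rfl⟩ ⟨d, hd, rfl⟩
    exact ⟨c + d, fun i => S.add_mem (hc i) (hd i), by simp [add_smul, Finset.sum_add_distrib]⟩
  smul_mem' := by
    rintro r x ⟨c, hc, rfl⟩
    exact ⟨r • c, fun i => S.smul_mem (hc i) r, by simp [Finset.smul_sum]⟩

theorem mem_coordSpan {S : Subalgebra R F} {n : ℕ} {b : Fin n → U} {x : U} :
    x ∈ coordSpan S b ↔ ∃ c : Fin n → F, (∀ i, c i ∈ S) ∧ x = ∑ i, c i • b i := Iff.rfl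

theorem smul_mem_coordSpan {S : Subalgebra R F} {n : ℕ} {b : Fin n → U} {x : U} {a : F}
    (ha : a ∈ S) (hx : x ∈ coordSpan S b) : a • x ∈ coordSpan S b := by
  obtain ⟨c, hc, rfl⟩ := hx
  exact ⟨a • c, fun i => S.mul_mem ha (hc i), by simp [Finset.smul_sum, smul_smul]⟩

theorem self_mem_coordSpan {S : Subalgebra R F} {n : ℕ} (b : Fin n → U) (i : Fin n) :
    b i ∈ coordSpan S b := by
  classical
  refine ⟨Pi.single i 1, fun j => ?_, by simp [Pi.single_apply]⟩
  rcases eq_or_ne j i with rfl | hj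
  · simp
  · simp [hj]

theorem coordSpan_le {S : Subalgebra R F} {n : ℕ} {b : Fin n → U} {N : Submodule R U}
    (hN : ∀ a ∈ S, ∀ x ∈ N, a • x ∈ N) (hb : ∀ i, b i ∈ N) : coordSpan S b ≤ N := by
  rintro x ⟨c, hc, rfl⟩
  exact N.sum_mem fun i _ => hN _ (hc i) _ (hb i)

theorem mem_coordSpan_basis {S : Subalgebra R F} {n : ℕ} {b : Module.Basis (Fin n) F U} {x : U} :
    x ∈ coordSpan S b ↔ ∀ i, b.repr x i ∈ S := by
  constructor
  · rintro ⟨c, hc, rfl⟩ i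
    simpa [Finsupp.single_apply] using hc i
  · exact fun h => ⟨fun i => b.repr x i, h, (b.sum_repr x).symm⟩

theorem map_coordSpan {S : Subalgebra R F} {U' : Type*} [AddCommGroup U'] [Module F U']
    [Module R U'] [IsScalarTower R F U'] (f : U →ₗ[F] U') {n : ℕ} (b : Fin n → U) :
    Submodule.map (f.restrictScalars R) (coordSpan S b) = coordSpan S (fun i => f (b i)) := by
  ext x
  constructor
  · rintro ⟨_, ⟨c, hc, rfl⟩, rfl⟩
    exact ⟨c, hc, by simp⟩
  · rintro ⟨c, hc, rfl⟩
    exact ⟨_, ⟨c, hc, rfl⟩, by simp⟩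

end Coordinates

section LocalBasis

variable {R F : Type*} [CommRing R] [IsDedekindDomain R] [Field F] [Algebra R F]
  [IsFractionRing R F]
variable {U : Type*} [AddCommGroup U] [Module F U] [Module R U] [IsScalarTower R F U]

theorem localAt_coordSpan (v : HeightOneSpectrum R) {n : ℕ} (b : Fin n → U) :
    localAt R U v (coordSpan (locRing R F v) b) = coordSpan (locRing R F v) b := by
  refine le_antisymm ?_ (le_localAt _ _)
  rintro x ⟨s, hs, hx⟩
  have := smul_mem_coordSpan (inv_mem_locRing (F := F) hs) hx
  rwa [← algebraMap_smul F s x, smul_smul,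
    inv_mul_cancel₀ (algebraMap_ne_zero_of_notMem_asIdeal hs), one_smul] at this

theorem exists_basis_localAt (v : HeightOneSpectrum R) {n : ℕ} (hn : finrank F U = n)
    [Module.Finite F U] {N : Submodule R U} (hN : IsLat R F U N) :
    ∃ b : Basis (Fin n) F U, localAt R U v N = coordSpan (locRing R F v) b := by
  let S := locRing R F v
  let N' : Submodule S U := Submodule.span S (N : Set U)
  have hlat : Submodule.IsLattice F N' := by
    refine ⟨?_, ?_⟩
    · obtain ⟨t, ht⟩ := hN.1
      refine ⟨t, le_antisymm (Submodule.span_mono ?_) (Submodule.span_le.2 ?_)⟩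
      · rw [← ht]; exact Submodule.subset_span
      · rw [← ht]
        intro x hx
        exact Submodule.span_subset_span R S _ hx
    · rw [eq_top_iff, ← hN.2]
      exact Submodule.span_mono Submodule.subset_span
  let b₀ := Module.Free.chooseBasis S N'
  let b₁ := b₀.extendOfIsLattice F
  have hcard : Fintype.card (Module.Free.ChooseBasisIndex S N') = n := by
    rw [← hn, Module.finrank_eq_card_basis b₁]
  let e := Fintype.equivFinOfCardEq hcard
  refine ⟨b₁.reindex e, le_antisymm ?_ ?_⟩
  · rw [← localAt_coordSpan, localAt_le_localAt_iff, localAt_coordSpan]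
    intro x hx
    have hx' : x ∈ N' := Submodule.subset_span hx
    refine ⟨fun i => (b₀.repr ⟨x, hx'⟩ (e.symm i) : S), fun i => SetLike.coe_mem _, ?_⟩
    have h1 := congrArg (Submodule.subtype N') (b₀.sum_repr ⟨x, hx'⟩)
    simp only [map_sum, map_smul, Submodule.subtype_apply] at h1
    refine h1.symm.trans ?_
    rw [← e.symm.sum_comp]
    refine Finset.sum_congr rfl fun i _ => ?_
    simp only [b₁, Basis.reindex_apply, Module.Basis.extendOfIsLattice_apply]
    rfl
  · refine coordSpan_le (fun a ha x hx => smul_mem_localAt ha hx) fun i => ?_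
    have key : ∀ x ∈ N', x ∈ localAt R U v N := by
      intro x hx
      induction hx using Submodule.span_induction with
      | mem x hx => exact le_localAt v N hx
      | zero => exact Submodule.zero_mem _
      | add x y _ _ hx hy => exact Submodule.add_mem _ hx hy
      | smul a x _ hx => exact smul_mem_localAt a.2 hx
    refine key _ ?_
    simp [b₁, Module.Basis.extendOfIsLattice_apply]

end LocalBasis

end Paper

namespace Paper

set_option linter.unusedSectionVars false

open IsDedekindDomain Module

section Index

variable {R F : Type*} [CommRing R] [IsDedekindDomain R] [Field F] [Algebra R F]
  [IsFractionRing R F]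

/-- The localization of `I` at `v` is generated by `d`. -/
def LocGen (v : HeightOneSpectrum R) (I : Submodule R F) (d : F) : Prop :=
  localAt R F v I = coordSpan (locRing R F v) (fun _ : Fin 1 => d)

theorem mem_coordSpan_const {S : Subalgebra R F} {d x : F} :
    x ∈ coordSpan S (fun _ : Fin 1 => d) ↔ ∃ c ∈ S, x = c * d := by
  constructor
  · rintro ⟨c, hc, rfl⟩
    exact ⟨c 0, hc 0, by simp⟩
  · rintro ⟨c, hc, rfl⟩
    exact ⟨fun _ => c, fun _ => hc, by simp⟩

theorem locGen_iff {v : HeightOneSpectrum R} {I : Submodule R F} {d : F} :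
    LocGen v I d ↔ d ∈ localAt R F v I ∧ ∀ x ∈ I, ∃ c ∈ locRing R F v, x = c * d := by
  constructor
  · intro h
    rw [LocGen] at h
    refine ⟨h ▸ self_mem_coordSpan _ 0, fun x hx => mem_coordSpan_const.1 ?_⟩
    rw [← h]
    exact le_localAt v I hx
  · rintro ⟨h1, h2⟩
    refine le_antisymm ?_ (coordSpan_le (fun a ha x hx => smul_mem_localAt ha hx) fun _ => h1)
    rw [← localAt_coordSpan, localAt_le_localAt_iff, localAt_coordSpan]
    exact fun x hx => mem_coordSpan_const.2 (h2 x hx)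

theorem LocGen.mul {v : HeightOneSpectrum R} {I J : Submodule R F} {d e : F}
    (hI : LocGen v I d) (hJ : LocGen v J e) : LocGen v (I * J) (d * e) := by
  rw [locGen_iff] at *
  obtain ⟨⟨s, hs, hd⟩, hI⟩ := hI
  obtain ⟨⟨t, ht, he⟩, hJ⟩ := hJ
  refine ⟨⟨s * t, mul_notMem_asIdeal hs ht, ?_⟩, fun x hx => ?_⟩
  · rw [← smul_mul_smul_comm]
    exact Submodule.mul_mem_mul hd he
  · induction hx using Submodule.mul_induction_on' with
    | mem_mul_mem m hm n hn =>
      obtain ⟨c, hc, rfl⟩ := hI m hm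
      obtain ⟨c', hc', rfl⟩ := hJ n hn
      exact ⟨c * c', mul_mem hc hc', by ring⟩
    | add x _ y _ hx hy =>
      obtain ⟨c, hc, rfl⟩ := hx
      obtain ⟨c', hc', rfl⟩ := hy
      exact ⟨c + c', add_mem hc hc', by ring⟩

theorem locGen_span_singleton (v : HeightOneSpectrum R) (d : F) :
    LocGen v (Submodule.span R {d}) d := by
  rw [locGen_iff]
  refine ⟨le_localAt _ _ (Submodule.mem_span_singleton_self d), fun x hx => ?_⟩
  obtain ⟨a, rfl⟩ := Submodule.mem_span_singleton.1 hx
  exact ⟨algebraMap R F a, Subalgebra.algebraMap_mem _ a, Algebra.smul_def _ _⟩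

theorem det_mem_of_forall_mem {S : Subalgebra R F} {n : ℕ} {A : Matrix (Fin n) (Fin n) F}
    (hA : ∀ i j, A i j ∈ S) : A.det ∈ S := by
  rw [Matrix.det_apply]
  exact sum_mem fun σ _ => S.toSubring.zsmul_mem (prod_mem fun i _ => hA _ _) _

variable {U : Type*} [AddCommGroup U] [Module F U] [Module R U] [IsScalarTower R F U]

theorem mem_dualLat {B : LinearMap.BilinForm F U} {N : Submodule R U} {x : U} :
    x ∈ dualLat R F U B N ↔ ∀ y ∈ N, 2 * B x y ∈ (algebraMap R F).range := by
  simp only [dualLat, Submodule.mem_iInf, Submodule.mem_comap]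
  rfl

/-- The Gram matrix of `2B`. -/
def gram2 (B : LinearMap.BilinForm F U) {n : ℕ} (b : Fin n → U) : Matrix (Fin n) (Fin n) F :=
  Matrix.of fun i j => 2 * B (b i) (b j)

/-- The map `x ↦ ∑ 2B(x, bᵢ) bᵢ`. -/
def gramMap (B : LinearMap.BilinForm F U) {n : ℕ} (b : Fin n → U) : U →ₗ[F] U :=
  ∑ i, LinearMap.toSpanSingleton F U (b i) ∘ₗ ((2 : F) • B.flip (b i))

theorem gramMap_apply (B : LinearMap.BilinForm F U) {n : ℕ} (b : Fin n → U) (x : U) :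
    gramMap B b x = ∑ i, (2 * B x (b i)) • b i := by
  simp [gramMap]

theorem det_gramMap (B : LinearMap.BilinForm F U) {n : ℕ} (b : Basis (Fin n) F U) :
    LinearMap.det (gramMap B b) = (gram2 B b).det := by
  rw [← LinearMap.det_toMatrix b, ← Matrix.det_transpose]
  congr 1
  ext i j
  rw [Matrix.transpose_apply, LinearMap.toMatrix_apply, gramMap_apply]
  simp [Finsupp.single_apply, gram2]

/-- A submodule on which the functionals `2B(·, s bᵢ)` are integral is finitely generated. -/
theorem fg_of_forall_mem_range {B : LinearMap.BilinForm F U} {n : ℕ} {b : Basis (Fin n) F U}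
    (hB : (gram2 B b).det ≠ 0) {s : R} (hs : s ≠ 0) {P : Submodule R U}
    (hP : ∀ x ∈ P, ∀ i, 2 * B x (s • b i) ∈ (algebraMap R F).range) : P.FG := by
  have hs' : algebraMap R F s ≠ 0 := fun h => hs ((IsFractionRing.to_map_eq_zero_iff).1 h)
  rw [← det_gramMap] at hB
  have : FiniteDimensional F U := b.finiteDimensional_of_finite
  let T : U →ₗ[R] U := ((algebraMap R F s) • gramMap B b).restrictScalars R
  have hT : Function.Injective T := by
    have h1 : Function.Injective (LinearMap.equivOfDetNeZero _ hB) :=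
      (LinearMap.equivOfDetNeZero _ hB).injective
    intro x y hxy
    exact h1 (smul_right_injective U hs' hxy)
  have hle : P.map T ≤ Submodule.span R (Set.range b) := by
    rintro _ ⟨x, hx, rfl⟩
    have : T x = ∑ i, (2 * B x (s • b i)) • b i := by
      simp only [T, LinearMap.restrictScalars_apply, LinearMap.smul_apply, gramMap_apply,
        Finset.smul_sum, smul_smul, ← algebraMap_smul F s, map_smul, smul_eq_mul]
      refine Finset.sum_congr rfl fun i _ => ?_
      congr 1
      ring
    rw [this]
    refine Submodule.sum_mem _ fun i _ => ?_
    obtain ⟨a, ha⟩ := hP x hx i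
    rw [← ha, algebraMap_smul]
    exact Submodule.smul_mem _ _ (Submodule.subset_span ⟨i, rfl⟩)
  have hfg : (P.map T).FG :=
    Submodule.FG.of_le (Submodule.fg_span (Set.finite_range b)) hle
  exact Submodule.fg_of_fg_map_injective T hT hfg

theorem locGen_latIdx_dualLat {B : LinearMap.BilinForm F U}
    {n : ℕ} {b : Basis (Fin n) F U} (hB : (gram2 B b).det ≠ 0) {N : Submodule R U} (hN : N.FG)
    {v : HeightOneSpectrum R} (hb : localAt R U v N = coordSpan (locRing R F v) b) :
    LocGen v (latIdx R F U (dualLat R F U B N) N) (gram2 B b).det := by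
  have : FiniteDimensional F U := b.finiteDimensional_of_finite
  have hB' : LinearMap.det (gramMap B b) ≠ 0 := by rwa [det_gramMap]
  let T := LinearMap.equivOfDetNeZero _ hB'
  have hT : ∀ x, T x = gramMap B b x := fun x => rfl
  have hfr : finrank F U = n := by rw [finrank_eq_card_basis b]; simp
  obtain ⟨s, hs, hsb⟩ := exists_smul_mem_of_forall_mem_localAt (N := N) (v := v) Finset.univ (x := b)
    fun i _ => by rw [hb]; exact self_mem_coordSpan _ i
  have hdualfg : (dualLat R F U B N).FG :=
    fg_of_forall_mem_range hB (ne_zero_of_notMem_asIdeal hs) fun x hx i =>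
      mem_dualLat.1 hx _ (hsb i (Finset.mem_univ i))
  have hTdual : (dualLat R F U B N).map (T.toLinearMap.restrictScalars R) ≤ localAt R U v N := by
    rintro _ ⟨x, hx, rfl⟩
    rw [hb]
    refine ⟨fun i => 2 * B x (b i), fun i => ⟨s, hs, ?_⟩, ?_⟩
    · have := mem_dualLat.1 hx _ (hsb i (Finset.mem_univ i))
      rwa [← algebraMap_smul F s, map_smul, smul_eq_mul, mul_left_comm, ← Algebra.smul_def] at this
    · exact gramMap_apply B b x
  have hdet : LinearMap.det (T : U →ₗ[F] U) = (gram2 B b).det := det_gramMap B b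
  rw [locGen_iff]
  constructor
  · obtain ⟨t, ht, htN⟩ := exists_smul_le_of_fg (hdualfg.map _) hTdual
    have ht' := algebraMap_ne_zero_of_notMem_asIdeal (F := F) ht
    refine ⟨t ^ n, pow_notMem_asIdeal ht n, Submodule.subset_span
      ⟨T.trans (LinearEquiv.smulOfNeZero F U _ ht'), fun x hx => ?_, ?_⟩⟩
    · have := htN _ ⟨x, hx, rfl⟩
      rwa [← algebraMap_smul F t] at this
    · have : ((T.trans (LinearEquiv.smulOfNeZero F U _ ht') : U ≃ₗ[F] U) : U →ₗ[F] U)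
          = algebraMap R F t • (T : U →ₗ[F] U) := by
        ext x; rfl
      rw [this, LinearMap.det_smul, hfr, hdet, Algebra.smul_def, map_pow]
  · intro x hx
    rw [← mem_coordSpan_const]
    revert x
    change latIdx R F U (dualLat R F U B N) N ≤ _
    refine Submodule.span_le.2 ?_
    rintro _ ⟨α, hα, rfl⟩
    rw [SetLike.mem_coe, mem_coordSpan_const]
    let C : U →ₗ[F] U := (T.symm.trans α : U ≃ₗ[F] U)
    refine ⟨LinearMap.det C, ?_, ?_⟩
    · have key : ∀ i, C (b i) ∈ localAt R U v N := by
        intro i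
        have h1 : ∀ j, 2 * B (T.symm (b i)) (b j) = if j = i then 1 else 0 := by
          have h2 : gramMap B b (T.symm (b i)) = b i := T.apply_symm_apply _
          rw [gramMap_apply] at h2
          intro j
          have := congrArg (fun x => b.repr x j) h2
          simpa [Finsupp.single_apply, eq_comm] using this
        have h2 : ∀ y ∈ N, 2 * B (T.symm (b i)) y ∈ locRing R F v := by
          intro y hy
          have hy' := le_localAt v N hy
          rw [hb] at hy'
          obtain ⟨c, hc, rfl⟩ := hy'
          simp only [map_sum, map_smul, smul_eq_mul, Finset.mul_sum, mul_left_comm _ (c _), h1]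
          simpa using hc i
        obtain ⟨t, ht, htN⟩ := exists_smul_le_of_fg (v := v) (N := N.map
          (((2 : F) • B (T.symm (b i))).restrictScalars R)) (N' := LinearMap.range (Algebra.linearMap R F))
          (hN.map _) (by
            rintro _ ⟨y, hy, rfl⟩
            exact h2 y hy)
        have h3 : t • T.symm (b i) ∈ dualLat R F U B N := by
          rw [mem_dualLat]
          intro y hy
          have := htN _ ⟨y, hy, rfl⟩
          rw [← algebraMap_smul F t, map_smul, LinearMap.smul_apply, smul_eq_mul, mul_left_comm,
            ← Algebra.smul_def]
          exact this
        refine ⟨t, ht, ?_⟩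
        have := hα _ h3
        rwa [← algebraMap_smul F t, map_smul, algebraMap_smul] at this
      rw [← LinearMap.det_toMatrix b]
      refine det_mem_of_forall_mem fun i j => ?_
      have := key j
      rw [hb, mem_coordSpan_basis] at this
      rw [LinearMap.toMatrix_apply]
      exact this i
    · rw [← hdet, ← LinearMap.det_comp]
      congr 1
      ext x
      simp [C]

end Index

end Paper

namespace Paper

set_option linter.unusedSectionVars false

open IsDedekindDomain Module CliffordAlgebra

section TernaryClifford

variable {R F : Type*} [CommRing R] [Field F] [Algebra R F]
variable {W : Type*} [AddCommGroup W] [Module F W] [Module R W] [IsScalarTower R F W]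
variable {Q : QuadraticForm F W}

theorem nontrivial_cliffordAlgebra [CharZero F] : Nontrivial (CliffordAlgebra Q) :=
  have : Invertible (2 : F) := invertibleOfNonzero two_ne_zero
  inferInstance

theorem algebraMap_cliffordAlgebra_injective [CharZero F] :
    Function.Injective (algebraMap F (CliffordAlgebra Q)) :=
  have : Nontrivial (CliffordAlgebra Q) := nontrivial_cliffordAlgebra
  (algebraMap F (CliffordAlgebra Q)).injective

theorem ι_mul_self (x : W) : ι Q x * ι Q x = Q x • 1 := by
  rw [ι_sq_scalar, Algebra.algebraMap_eq_smul_one]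

theorem ι_mul_self_mul (x : W) (t : CliffordAlgebra Q) : ι Q x * (ι Q x * t) = Q x • t := by
  rw [← mul_assoc, ι_mul_self, smul_mul_assoc, one_mul]

theorem ι_swap (x y : W) : ι Q y * ι Q x = QuadraticMap.polar Q x y • 1 - ι Q x * ι Q y := by
  rw [ι_mul_ι_comm, Algebra.algebraMap_eq_smul_one, QuadraticMap.polar_comm]

theorem ι_swap_mul (x y : W) (t : CliffordAlgebra Q) :
    ι Q y * (ι Q x * t) = QuadraticMap.polar Q x y • t - ι Q x * (ι Q y * t) := by
  rw [← mul_assoc, ι_swap, sub_mul, smul_mul_assoc, one_mul, mul_assoc]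

/-- The family `1, e₁e₂, e₂e₀, e₀e₁` of even elements. -/
def evenFam (Q : QuadraticForm F W) (e : Fin 3 → W) : Fin 4 → CliffordAlgebra Q :=
  ![1, ι Q (e 1) * ι Q (e 2), ι Q (e 2) * ι Q (e 0), ι Q (e 0) * ι Q (e 1)]

/-- The family `e₀, e₁, e₂, e₀e₁e₂` of odd elements. -/
def oddFam (Q : QuadraticForm F W) (e : Fin 3 → W) : Fin 4 → CliffordAlgebra Q :=
  ![ι Q (e 0), ι Q (e 1), ι Q (e 2), ι Q (e 0) * (ι Q (e 1) * ι Q (e 2))]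

/-- The form `Q` takes values in `S` on the `S`-span of `e`. -/
def FamIntegral (S : Subalgebra R F) (Q : QuadraticForm F W) (e : Fin 3 → W) : Prop :=
  (∀ i, Q (e i) ∈ S) ∧ ∀ i j, QuadraticMap.polar Q (e i) (e j) ∈ S

theorem ι_mul_evenFam_mem {S : Subalgebra R F} {e : Fin 3 → W} (he : FamIntegral S Q e)
    (i : Fin 3) (j : Fin 4) : ι Q (e i) * evenFam Q e j ∈ coordSpan S (oddFam Q e) := by
  have hQ := he.1
  have hP := he.2
  have h0 := S.zero_mem
  have h1 := S.one_mem
  have key : ∀ c : Fin 4 → F, (∀ k, c k ∈ S) →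
      ι Q (e i) * evenFam Q e j = c 0 • ι Q (e 0) + c 1 • ι Q (e 1) + c 2 • ι Q (e 2) +
        c 3 • (ι Q (e 0) * (ι Q (e 1) * ι Q (e 2))) →
      ι Q (e i) * evenFam Q e j ∈ coordSpan S (oddFam Q e) := fun c hc h =>
    ⟨c, hc, by rw [h]; simp [Fin.sum_univ_four, oddFam]⟩
  have hS : ∀ a b c d : F, a ∈ S → b ∈ S → c ∈ S → d ∈ S → ∀ k, ![a, b, c, d] k ∈ S := by
    intro a b c d ha hb hc hd k
    fin_cases k <;> assumption
  have r01 := ι_swap (Q := Q) (e 0) (e 1)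
  have r02 := ι_swap (Q := Q) (e 0) (e 2)
  have r12 := ι_swap (Q := Q) (e 1) (e 2)
  have t01 := ι_swap_mul (Q := Q) (e 0) (e 1)
  have t02 := ι_swap_mul (Q := Q) (e 0) (e 2)
  have t12 := ι_swap_mul (Q := Q) (e 1) (e 2)
  fin_cases i <;> fin_cases j
  · refine key ![1, 0, 0, 0] (hS _ _ _ _ h1 h0 h0 h0) ?_
    simp [evenFam]
  · refine key ![0, 0, 0, 1] (hS _ _ _ _ h0 h0 h0 h1) ?_
    simp [evenFam]
  · refine key ![QuadraticMap.polar Q (e 0) (e 2), 0, - Q (e 0), 0]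
      (hS _ _ _ _ (hP _ _) h0 (neg_mem (hQ _)) h0) ?_
    simp [evenFam, r02, mul_sub, ι_mul_self_mul, -ι_sq_scalar]
    module
  · refine key ![0, Q (e 0), 0, 0] (hS _ _ _ _ h0 (hQ _) h0 h0) ?_
    simp [evenFam, ι_mul_self_mul]
  · refine key ![0, 1, 0, 0] (hS _ _ _ _ h0 h1 h0 h0) ?_
    simp [evenFam]
  · refine key ![0, 0, Q (e 1), 0] (hS _ _ _ _ h0 h0 (hQ _) h0) ?_
    simp [evenFam, ι_mul_self_mul]
  · refine key ![0, QuadraticMap.polar Q (e 0) (e 2), -QuadraticMap.polar Q (e 0) (e 1), 1]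
      (hS _ _ _ _ h0 (hP _ _) (neg_mem (hP _ _)) h1) ?_
    simp [evenFam, r02, t01, mul_sub]
    module
  · refine key ![- Q (e 1), QuadraticMap.polar Q (e 0) (e 1), 0, 0]
      (hS _ _ _ _ (neg_mem (hQ _)) (hP _ _) h0 h0) ?_
    simp [evenFam, t01, ι_mul_self, -ι_sq_scalar]
    module
  · refine key ![0, 0, 1, 0] (hS _ _ _ _ h0 h0 h1 h0) ?_
    simp [evenFam]
  · refine key ![0, - Q (e 2), QuadraticMap.polar Q (e 1) (e 2), 0]
      (hS _ _ _ _ h0 (neg_mem (hQ _)) (hP _ _) h0) ?_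
    simp [evenFam, t12, ι_mul_self, -ι_sq_scalar]
    module
  · refine key ![Q (e 2), 0, 0, 0] (hS _ _ _ _ (hQ _) h0 h0 h0) ?_
    simp [evenFam, ι_mul_self_mul]
  · refine key ![-QuadraticMap.polar Q (e 1) (e 2), QuadraticMap.polar Q (e 0) (e 2), 0, 1]
      (hS _ _ _ _ (neg_mem (hP _ _)) (hP _ _) h0 h1) ?_
    simp [evenFam, t02, r12, mul_sub]
    module

theorem ι_mul_oddFam_mem {S : Subalgebra R F} {e : Fin 3 → W} (he : FamIntegral S Q e)
    (i : Fin 3) (j : Fin 4) : ι Q (e i) * oddFam Q e j ∈ coordSpan S (evenFam Q e) := by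
  have hQ := he.1
  have hP := he.2
  have h0 := S.zero_mem
  have h1 := S.one_mem
  have r02 := ι_swap (Q := Q) (e 0) (e 2)
  have key : ∀ c : Fin 4 → F, (∀ k, c k ∈ S) →
      ι Q (e i) * oddFam Q e j = c 0 • 1 + c 1 • (ι Q (e 1) * ι Q (e 2)) +
        c 2 • (QuadraticMap.polar Q (e 0) (e 2) • 1 - ι Q (e 0) * ι Q (e 2)) +
        c 3 • (ι Q (e 0) * ι Q (e 1)) →
      ι Q (e i) * oddFam Q e j ∈ coordSpan S (evenFam Q e) := fun c hc h =>
    ⟨c, hc, by rw [h]; simp [Fin.sum_univ_four, evenFam, r02]⟩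
  have hS : ∀ a b c d : F, a ∈ S → b ∈ S → c ∈ S → d ∈ S → ∀ k, ![a, b, c, d] k ∈ S := by
    intro a b c d ha hb hc hd k
    fin_cases k <;> assumption
  have r01 := ι_swap (Q := Q) (e 0) (e 1)
  have r12 := ι_swap (Q := Q) (e 1) (e 2)
  have t01 := ι_swap_mul (Q := Q) (e 0) (e 1)
  have t02 := ι_swap_mul (Q := Q) (e 0) (e 2)
  have t12 := ι_swap_mul (Q := Q) (e 1) (e 2)
  fin_cases i <;> fin_cases j
  · refine key ![Q (e 0), 0, 0, 0] (hS _ _ _ _ (hQ _) h0 h0 h0) ?_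
    simp [oddFam, ι_mul_self, -ι_sq_scalar]
  · refine key ![0, 0, 0, 1] (hS _ _ _ _ h0 h0 h0 h1) ?_
    simp [oddFam]
  · refine key ![QuadraticMap.polar Q (e 0) (e 2), 0, -1, 0]
      (hS _ _ _ _ (hP _ _) h0 (neg_mem h1) h0) ?_
    simp [oddFam]
  · refine key ![0, Q (e 0), 0, 0] (hS _ _ _ _ h0 (hQ _) h0 h0) ?_
    simp [oddFam, ι_mul_self_mul]
  · refine key ![QuadraticMap.polar Q (e 0) (e 1), 0, 0, -1]
      (hS _ _ _ _ (hP _ _) h0 h0 (neg_mem h1)) ?_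
    simp [oddFam, r01]
    module
  · refine key ![Q (e 1), 0, 0, 0] (hS _ _ _ _ (hQ _) h0 h0 h0) ?_
    simp [oddFam, ι_mul_self, -ι_sq_scalar]
  · refine key ![0, 1, 0, 0] (hS _ _ _ _ h0 h1 h0 h0) ?_
    simp [oddFam]
  · refine key ![- Q (e 1) * QuadraticMap.polar Q (e 0) (e 2), QuadraticMap.polar Q (e 0) (e 1),
      Q (e 1), 0] (hS _ _ _ _ (mul_mem (neg_mem (hQ _)) (hP _ _)) (hP _ _) (hQ _) h0) ?_
    simp [oddFam, t01, ι_mul_self_mul]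
    module
  · refine key ![0, 0, 1, 0] (hS _ _ _ _ h0 h0 h1 h0) ?_
    simp [oddFam, r02]
  · refine key ![QuadraticMap.polar Q (e 1) (e 2), -1, 0, 0]
      (hS _ _ _ _ (hP _ _) (neg_mem h1) h0 h0) ?_
    simp [oddFam, r12]
    module
  · refine key ![Q (e 2), 0, 0, 0] (hS _ _ _ _ (hQ _) h0 h0 h0) ?_
    simp [oddFam, ι_mul_self, -ι_sq_scalar]
  · refine key ![- QuadraticMap.polar Q (e 1) (e 2) * QuadraticMap.polar Q (e 0) (e 2),
      QuadraticMap.polar Q (e 0) (e 2), QuadraticMap.polar Q (e 1) (e 2), Q (e 2)]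
      (hS _ _ _ _ (mul_mem (neg_mem (hP _ _)) (hP _ _)) (hP _ _) (hP _ _) (hQ _)) ?_
    simp [oddFam, t02, t12, ι_mul_self, mul_sub, -ι_sq_scalar]
    module

theorem ι_mul_ι_mem_evenR (x y : W) : ι Q x * ι Q y ∈ Subalgebra.toSubmodule (evenR R F W Q) :=
  ι_mul_ι_mem_evenOdd_zero Q x y

theorem coordSpan_evenFam_le_evenR (S : Subalgebra R F) (e : Fin 3 → W) :
    coordSpan S (evenFam Q e) ≤ Subalgebra.toSubmodule (evenR R F W Q) := by
  refine coordSpan_le (fun a _ x hx => (even Q).smul_mem hx a) ?_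
  simp only [Fin.forall_fin_succ, evenFam]
  simp [ι_mul_ι_mem_evenR, -Subalgebra.mem_toSubmodule]
  exact (even Q).one_mem

theorem mul_mem_evenOdd_one {x y : CliffordAlgebra Q} (hx : x ∈ evenOdd Q 1)
    (hy : y ∈ evenOdd Q 0) : x * y ∈ evenOdd Q 1 := by
  have := SetLike.mul_mem_graded hx hy
  rwa [add_zero] at this

theorem coordSpan_oddFam_le (S : Subalgebra R F) (e : Fin 3 → W) {x : CliffordAlgebra Q}
    (hx : x ∈ coordSpan S (oddFam Q e)) : x ∈ evenOdd Q 1 := by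
  have hι : ∀ w : W, ι Q w ∈ (evenOdd Q 1).restrictScalars R := ι_mem_evenOdd_one Q
  have h3 : ∀ x y z : W, ι Q x * (ι Q y * ι Q z) ∈ (evenOdd Q 1).restrictScalars R :=
    fun x y z => mul_mem_evenOdd_one (ι_mem_evenOdd_one Q x) (ι_mul_ι_mem_evenOdd_zero Q y z)
  suffices coordSpan S (oddFam Q e) ≤ (evenOdd Q 1).restrictScalars R from this hx
  refine coordSpan_le (fun a _ x hx => (evenOdd Q 1).smul_mem a hx) ?_
  simp only [Fin.forall_fin_succ, oddFam]
  simp [hι, h3, -Submodule.restrictScalars_mem]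

theorem disjoint_evenOdd {x : CliffordAlgebra Q} (h0 : x ∈ evenOdd Q 0) (h1 : x ∈ evenOdd Q 1) :
    x = 0 :=
  (Submodule.disjoint_def.1 (evenOdd_isCompl Q).disjoint) x h0 h1

theorem cliffordOrder_le {S : Subalgebra R F} {e : Fin 3 → W} (he : FamIntegral S Q e)
    {N : Submodule R W} (hN : N ≤ coordSpan S e) :
    Subalgebra.toSubmodule (cliffordOrder R F W Q N) ≤
      coordSpan S (evenFam Q e) ⊔ coordSpan S (oddFam Q e) := by
  set T := coordSpan S (evenFam Q e) ⊔ coordSpan S (oddFam Q e) with hT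
  have hTS : ∀ a ∈ S, ∀ x ∈ T, a • x ∈ T := by
    intro a ha x hx
    obtain ⟨y, hy, z, hz, rfl⟩ := Submodule.mem_sup.1 hx
    rw [smul_add]
    exact Submodule.add_mem_sup (smul_mem_coordSpan ha hy) (smul_mem_coordSpan ha hz)
  have hgen : ∀ i, ∀ t ∈ T, ι Q (e i) * t ∈ T := by
    intro i
    suffices T ≤ T.comap ((LinearMap.mulLeft F (ι Q (e i))).restrictScalars R) from
      fun t ht => this ht
    have hcl : ∀ a ∈ S, ∀ x ∈ T.comap ((LinearMap.mulLeft F (ι Q (e i))).restrictScalars R),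
        a • x ∈ T.comap ((LinearMap.mulLeft F (ι Q (e i))).restrictScalars R) := by
      intro a ha x hx
      have : ι Q (e i) * (a • x) = a • (ι Q (e i) * x) := mul_smul_comm _ _ _
      change ι Q (e i) * (a • x) ∈ T
      rw [this]
      exact hTS a ha _ hx
    refine sup_le (coordSpan_le hcl fun j => ?_) (coordSpan_le hcl fun j => ?_)
    · exact (le_sup_right : coordSpan S (oddFam Q e) ≤ T) (ι_mul_evenFam_mem he i j)
    · exact (le_sup_left : coordSpan S (evenFam Q e) ≤ T) (ι_mul_oddFam_mem he i j)
  have hmul : ∀ x ∈ cliffordOrder R F W Q N, ∀ t ∈ T, x * t ∈ T := by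
    intro x hx
    induction hx using Algebra.adjoin_induction with
    | mem x hx =>
      obtain ⟨w, hw, rfl⟩ := hx
      obtain ⟨c, hc, rfl⟩ := hN hw
      intro t ht
      rw [map_sum, Finset.sum_mul]
      refine T.sum_mem fun i _ => ?_
      rw [map_smul, smul_mul_assoc]
      exact hTS _ (hc i) _ (hgen i t ht)
    | algebraMap r =>
      intro t ht
      rw [← Algebra.smul_def]
      exact T.smul_mem r ht
    | add x y _ _ hx hy =>
      intro t ht
      rw [add_mul]
      exact T.add_mem (hx t ht) (hy t ht)
    | mul x y _ _ hx hy =>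
      intro t ht
      rw [mul_assoc]
      exact hx _ (hy t ht)
  intro x hx
  have h1 : (1 : CliffordAlgebra Q) ∈ T :=
    (le_sup_left : coordSpan S (evenFam Q e) ≤ T) (self_mem_coordSpan (evenFam Q e) 0)
  simpa using hmul x hx 1 h1

theorem APlusSub_le {S : Subalgebra R F} {e : Fin 3 → W} (he : FamIntegral S Q e)
    {N : Submodule R W} (hN : N ≤ coordSpan S e) :
    APlusSub R F W Q N ≤ coordSpan S (evenFam Q e) := by
  rintro x ⟨hx0, hx⟩
  obtain ⟨y, hy, z, hz, rfl⟩ := Submodule.mem_sup.1 (cliffordOrder_le he hN hx)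
  have hy0 : y ∈ evenOdd Q 0 := coordSpan_evenFam_le_evenR S e hy
  have hz0 : z ∈ evenOdd Q 0 := by
    have := (evenOdd Q 0).sub_mem (show y + z ∈ evenOdd Q 0 from hx0) hy0
    rwa [add_sub_cancel_left] at this
  rw [disjoint_evenOdd hz0 (coordSpan_oddFam_le S e hz), add_zero]
  exact hy

theorem famIntegral_top (e : Fin 3 → W) : FamIntegral (⊤ : Subalgebra F F) Q e :=
  ⟨fun _ => Algebra.mem_top, fun _ _ => Algebra.mem_top⟩

theorem sup_coordSpan_eq_top (e : Basis (Fin 3) F W) :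
    coordSpan (⊤ : Subalgebra F F) (evenFam Q e) ⊔ coordSpan (⊤ : Subalgebra F F) (oddFam Q e)
      = ⊤ := by
  rw [eq_top_iff]
  refine le_trans ?_ (cliffordOrder_le (R := F) (famIntegral_top e)
    (N := (⊤ : Submodule F W)) fun x _ => mem_coordSpan_basis.2 fun i => Algebra.mem_top)
  rw [cliffordOrder, Submodule.top_coe, Set.image_univ, adjoin_range_ι]
  exact le_rfl

theorem mem_even_iff (e : Basis (Fin 3) F W) {x : CliffordAlgebra Q} :
    x ∈ even Q ↔ ∃ c : Fin 4 → F, x = ∑ i, c i • evenFam Q e i := by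
  constructor
  · intro hx
    have : x ∈ coordSpan (⊤ : Subalgebra F F) (evenFam Q e) ⊔
      coordSpan (⊤ : Subalgebra F F) (oddFam Q e) := sup_coordSpan_eq_top (Q := Q) e ▸ trivial
    obtain ⟨y, hy, z, hz, rfl⟩ := Submodule.mem_sup.1 this
    have hy0 : y ∈ evenOdd Q 0 := coordSpan_evenFam_le_evenR _ e hy
    have hz0 : z ∈ evenOdd Q 0 := by
      have := (evenOdd Q 0).sub_mem (show y + z ∈ evenOdd Q 0 from hx) hy0
      rwa [add_sub_cancel_left] at this
    rw [disjoint_evenOdd hz0 (coordSpan_oddFam_le _ e hz), add_zero]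
    obtain ⟨c, -, hc⟩ := hy
    exact ⟨c, hc⟩
  · rintro ⟨c, rfl⟩
    exact coordSpan_evenFam_le_evenR (⊤ : Subalgebra F F) e ⟨c, fun _ => Algebra.mem_top, rfl⟩

theorem exists_eq_sum_oddFam (e : Basis (Fin 3) F W) {x : CliffordAlgebra Q}
    (hx : x ∈ evenOdd Q 1) : ∃ c : Fin 4 → F, x = ∑ i, c i • oddFam Q e i := by
  have : x ∈ coordSpan (⊤ : Subalgebra F F) (evenFam Q e) ⊔
    coordSpan (⊤ : Subalgebra F F) (oddFam Q e) := sup_coordSpan_eq_top (Q := Q) e ▸ trivial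
  obtain ⟨y, hy, z, hz, rfl⟩ := Submodule.mem_sup.1 this
  have hz0 : z ∈ evenOdd Q 1 := coordSpan_oddFam_le _ e hz
  have hy1 : y ∈ evenOdd Q 1 := by
    have := (evenOdd Q 1).sub_mem hx hz0
    rwa [add_sub_cancel_right] at this
  rw [disjoint_evenOdd (coordSpan_evenFam_le_evenR _ e hy) hy1, zero_add]
  obtain ⟨c, -, hc⟩ := hz
  exact ⟨c, hc⟩

end TernaryClifford

section LocalEven

variable {R F : Type*} [CommRing R] [IsDedekindDomain R] [Field F] [Algebra R F]
  [IsFractionRing R F]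
variable {W : Type*} [AddCommGroup W] [Module F W] [Module R W] [IsScalarTower R F W]
variable {Q : QuadraticForm F W}

theorem APlusSub_mono {N N' : Submodule R W} (h : N ≤ N') :
    APlusSub R F W Q N ≤ APlusSub R F W Q N' := fun _ hx =>
  ⟨hx.1, Algebra.adjoin_mono (Set.image_mono h) hx.2⟩

theorem cliffordOrder_localAt_le (v : HeightOneSpectrum R) (N : Submodule R W) :
    Subalgebra.toSubmodule (cliffordOrder R F W Q (localAt R W v N)) ≤
      localAt R _ v (Subalgebra.toSubmodule (cliffordOrder R F W Q N)) := by
  intro x hx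
  induction hx using Algebra.adjoin_induction with
  | mem x hx =>
    obtain ⟨w, ⟨s, hs, hw⟩, rfl⟩ := hx
    refine ⟨s, hs, Algebra.subset_adjoin ⟨s • w, hw, ?_⟩⟩
    rw [← algebraMap_smul F s w, map_smul, algebraMap_smul]
  | algebraMap r => exact le_localAt v _ (Subalgebra.algebraMap_mem _ r)
  | add x y _ _ hx hy => exact Submodule.add_mem _ hx hy
  | mul x y _ _ hx hy =>
    obtain ⟨s, hs, hx⟩ := hx
    obtain ⟨t, ht, hy⟩ := hy
    refine ⟨s * t, mul_notMem_asIdeal hs ht, ?_⟩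
    rw [← smul_mul_smul_comm]
    exact Subalgebra.mul_mem _ hx hy

theorem localAt_evenR (v : HeightOneSpectrum R) :
    localAt R _ v (Subalgebra.toSubmodule (evenR R F W Q)) =
      Subalgebra.toSubmodule (evenR R F W Q) := by
  refine le_antisymm ?_ (le_localAt _ _)
  rintro x ⟨s, hs, hx⟩
  have hs0 := algebraMap_ne_zero_of_notMem_asIdeal (F := F) hs
  have : (algebraMap R F s)⁻¹ • s • x ∈ even Q := (even Q).smul_mem hx _
  rwa [← algebraMap_smul F s x, smul_smul, inv_mul_cancel₀ hs0, one_smul] at this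

theorem APlusSub_eq_inf (N : Submodule R W) : APlusSub R F W Q N =
    Subalgebra.toSubmodule (evenR R F W Q) ⊓ Subalgebra.toSubmodule (cliffordOrder R F W Q N) :=
  rfl

theorem localAt_APlusSub_localAt (v : HeightOneSpectrum R) (N : Submodule R W) :
    localAt R _ v (APlusSub R F W Q (localAt R W v N)) = localAt R _ v (APlusSub R F W Q N) := by
  refine le_antisymm ?_ (localAt_mono v (APlusSub_mono (le_localAt v N)))
  rw [localAt_le_localAt_iff]
  conv_rhs => rw [APlusSub_eq_inf, localAt_inf, localAt_evenR]
  exact le_inf (fun x hx => hx.1) fun x hx => cliffordOrder_localAt_le v N hx.2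

theorem localAt_APlusSub {v : HeightOneSpectrum R} {N : Submodule R W} {e : Fin 3 → W}
    (he : FamIntegral (locRing R F v) Q e) (hN : localAt R W v N = coordSpan (locRing R F v) e) :
    localAt R _ v (APlusSub R F W Q N) = coordSpan (locRing R F v) (evenFam Q e) := by
  refine le_antisymm ?_ ?_
  · rw [← localAt_coordSpan, localAt_le_localAt_iff, localAt_coordSpan]
    exact APlusSub_le he (hN ▸ le_localAt v N)
  · refine coordSpan_le (fun a ha x hx => smul_mem_localAt ha hx) fun i => ?_
    rw [← localAt_APlusSub_localAt]
    refine le_localAt v _ ⟨coordSpan_evenFam_le_evenR (locRing R F v) e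
      (self_mem_coordSpan (evenFam Q e) i), ?_⟩
    have hmem : ∀ j, ι Q (e j) ∈ cliffordOrder R F W Q (localAt R W v N) := fun j =>
      Algebra.subset_adjoin ⟨e j, by rw [hN]; exact self_mem_coordSpan e j, rfl⟩
    fin_cases i
    · exact Subalgebra.one_mem _
    all_goals exact Subalgebra.mul_mem _ (hmem _) (hmem _)

end LocalEven

section NormForm

variable {R F : Type*} [CommRing R] [Field F] [Algebra R F]
variable {W : Type*} [AddCommGroup W] [Module F W] [Module R W] [IsScalarTower R F W]
variable {Q : QuadraticForm F W}

/-- The bilinear map `(x, y) ↦ x y* + y x*`. -/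
def normTrace (Q : QuadraticForm F W) :
    CliffordAlgebra Q →ₗ[F] CliffordAlgebra Q →ₗ[F] CliffordAlgebra Q :=
  LinearMap.mk₂ F (fun x y => x * reverse y + y * reverse x)
    (fun x x' y => by simp [add_mul, mul_add]; abel)
    (fun c x y => by simp)
    (fun x y y' => by simp [add_mul, mul_add]; abel)
    (fun c x y => by simp)

theorem normTrace_apply (x y : CliffordAlgebra Q) :
    normTrace Q x y = x * reverse y + y * reverse x := rfl

/-- The Gram matrix of `1, e₁e₂, e₂e₀, e₀e₁` for `x y* + y x*`. -/
def evenGram (Q : QuadraticForm F W) (e : Fin 3 → W) : Matrix (Fin 4) (Fin 4) F :=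
  let a := Q (e 0)
  let b := Q (e 1)
  let c := Q (e 2)
  let u := QuadraticMap.polar Q (e 1) (e 2)
  let v := QuadraticMap.polar Q (e 0) (e 2)
  let w := QuadraticMap.polar Q (e 0) (e 1)
  !![2, u, v, w; u, 2 * (b * c), u * v - c * w, u * w - b * v;
    v, u * v - c * w, 2 * (c * a), v * w - a * u;
    w, u * w - b * v, v * w - a * u, 2 * (a * b)]

/-- The half-discriminant of a ternary form. -/
def halfDisc (Q : QuadraticForm F W) (e : Fin 3 → W) : F :=
  let a := Q (e 0)
  let b := Q (e 1)
  let c := Q (e 2)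
  let u := QuadraticMap.polar Q (e 1) (e 2)
  let v := QuadraticMap.polar Q (e 0) (e 2)
  let w := QuadraticMap.polar Q (e 0) (e 1)
  4 * a * b * c + u * v * w - a * u ^ 2 - b * v ^ 2 - c * w ^ 2

theorem det_evenGram (e : Fin 3 → W) : (evenGram Q e).det = halfDisc Q e ^ 2 := by
  simp [evenGram, halfDisc, Matrix.det_succ_row_zero, Fin.sum_univ_succ, Fin.succAbove]
  ring

theorem normTrace_evenFam (e : Fin 3 → W) (i j : Fin 4) :
    normTrace Q (evenFam Q e i) (evenFam Q e j) = evenGram Q e i j • 1 := by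
  have r01 := ι_swap (Q := Q) (e 0) (e 1)
  have r02 := ι_swap (Q := Q) (e 0) (e 2)
  have r12 := ι_swap (Q := Q) (e 1) (e 2)
  have t01 := ι_swap_mul (Q := Q) (e 0) (e 1)
  have t02 := ι_swap_mul (Q := Q) (e 0) (e 2)
  have t12 := ι_swap_mul (Q := Q) (e 1) (e 2)
  rw [normTrace_apply]
  fin_cases i <;> fin_cases j <;>
  · simp [evenFam, evenGram, mul_assoc, r01, r02, r12, t01, t02, t12, ι_mul_self, ι_mul_self_mul,
      mul_sub, sub_mul, smul_sub, -ι_sq_scalar]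
    try module

theorem FamIntegral.evenGram_mem {S : Subalgebra R F} {e : Fin 3 → W} (he : FamIntegral S Q e)
    (i j : Fin 4) : evenGram Q e i j ∈ S := by
  have hQ := he.1
  have hP := he.2
  have h2 : (2 : F) ∈ S := by
    have := add_mem S.one_mem S.one_mem
    rwa [one_add_one_eq_two] at this
  fin_cases i <;> fin_cases j <;> simp only [evenGram] <;>
  first
  | exact h2
  | exact hP _ _
  | exact mul_mem h2 (mul_mem (hQ _) (hQ _))
  | exact sub_mem (mul_mem (hP _ _) (hP _ _)) (mul_mem (hQ _) (hP _ _))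

theorem normTrace_mem_of_coordSpan {S : Subalgebra R F} {e : Fin 3 → W} (he : FamIntegral S Q e)
    {x y : CliffordAlgebra Q} (hx : x ∈ coordSpan S (evenFam Q e))
    (hy : y ∈ coordSpan S (evenFam Q e)) : ∃ s ∈ S, normTrace Q x y = s • 1 := by
  obtain ⟨c, hc, rfl⟩ := hx
  obtain ⟨d, hd, rfl⟩ := hy
  refine ⟨∑ i, ∑ j, c i * (d j * evenGram Q e i j), sum_mem fun i _ => sum_mem fun j _ =>
    mul_mem (hc i) (mul_mem (hd j) (he.evenGram_mem i j)), ?_⟩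
  simp only [map_sum, LinearMap.sum_apply, map_smul, LinearMap.smul_apply, normTrace_evenFam,
    Finset.sum_smul, smul_smul, Finset.smul_sum]
  rw [Finset.sum_comm]
  refine Finset.sum_congr rfl fun i _ => Finset.sum_congr rfl fun j _ => ?_
  congr 1
  ring

variable [CharZero F]

theorem smul_one_injective {a b : F} (h : a • (1 : CliffordAlgebra Q) = b • 1) : a = b :=
  algebraMap_cliffordAlgebra_injective (Q := Q) (by rwa [Algebra.algebraMap_eq_smul_one,
    Algebra.algebraMap_eq_smul_one])

variable (Q) in
theorem exists_scalarPart : ∃ l : CliffordAlgebra Q →ₗ[F] F, ∀ a : F, l (a • 1) = a := by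
  obtain ⟨l, hl⟩ := LinearMap.exists_leftInverse_of_injective
    (LinearMap.toSpanSingleton F (CliffordAlgebra Q) 1)
    (LinearMap.ker_eq_bot.2 fun a b h => smul_one_injective (Q := Q) h)
  exact ⟨l, fun a => LinearMap.congr_fun hl a⟩

variable (Q) in
/-- A linear form on the Clifford algebra extending the identity on scalars. -/
noncomputable def scalarPart : CliffordAlgebra Q →ₗ[F] F := (exists_scalarPart Q).choose

theorem scalarPart_smul_one (a : F) : scalarPart Q (a • 1) = a :=
  (exists_scalarPart Q).choose_spec a

variable (Q) in
/-- The space underlying the even Clifford algebra. -/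
abbrev EvenSpace : Type _ := ↥(Subalgebra.toSubmodule (even Q))

variable (Q) in
/-- The bilinear norm form on the even Clifford algebra. -/
noncomputable def normForm : LinearMap.BilinForm F (EvenSpace Q) :=
  ((2 : F)⁻¹ • (normTrace Q).compr₂ (scalarPart Q)).compl₁₂
    (Subalgebra.toSubmodule (even Q)).subtype (Subalgebra.toSubmodule (even Q)).subtype

theorem two_mul_normForm (x y : EvenSpace Q) :
    2 * normForm Q x y = scalarPart Q (normTrace Q x y) := by
  change 2 * (2⁻¹ * scalarPart Q (normTrace Q x y)) = _
  rw [mul_inv_cancel_left₀ two_ne_zero]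

theorem normTrace_eq_smul_one (e : Basis (Fin 3) F W) {x y : CliffordAlgebra Q} (hx : x ∈ even Q)
    (hy : y ∈ even Q) : normTrace Q x y = scalarPart Q (normTrace Q x y) • 1 := by
  obtain ⟨c, rfl⟩ := (mem_even_iff e).1 hx
  obtain ⟨d, rfl⟩ := (mem_even_iff e).1 hy
  obtain ⟨s, -, hs⟩ := normTrace_mem_of_coordSpan (Q := Q) (famIntegral_top e)
    (x := ∑ i, c i • evenFam Q e i) (y := ∑ i, d i • evenFam Q e i)
    ⟨c, fun _ => Algebra.mem_top, rfl⟩ ⟨d, fun _ => Algebra.mem_top, rfl⟩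
  rw [hs, scalarPart_smul_one]

theorem linearIndependent_evenFam {e : Basis (Fin 3) F W} (he : halfDisc Q e ≠ 0) :
    LinearIndependent F (evenFam Q e) := by
  rw [Fintype.linearIndependent_iff]
  intro c hc
  have hG : (evenGram Q e).det ≠ 0 := by
    rw [det_evenGram]
    exact pow_ne_zero 2 he
  suffices h : Matrix.vecMul c (evenGram Q e) = 0 from
    fun i => congrFun (Matrix.eq_zero_of_vecMul_eq_zero hG h) i
  ext j
  have := congrArg (fun x => normTrace Q x (evenFam Q e j)) hc
  simp only [map_sum, LinearMap.sum_apply, map_smul, LinearMap.smul_apply, normTrace_evenFam,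
    map_zero, LinearMap.zero_apply, smul_smul, ← Finset.sum_smul] at this
  rw [← zero_smul F (1 : CliffordAlgebra Q)] at this
  exact smul_one_injective this

theorem evenFam_mem (e : Basis (Fin 3) F W) (i : Fin 4) : evenFam Q e i ∈ even Q :=
  (mem_even_iff e).2 ⟨Pi.single i 1, by simp [Pi.single_apply]⟩

/-- The basis `1, e₁e₂, e₂e₀, e₀e₁` of the even Clifford algebra. -/
noncomputable def evenBasis {e : Basis (Fin 3) F W} (he : halfDisc Q e ≠ 0) :
    Basis (Fin 4) F (EvenSpace Q) :=
  Basis.mk (v := fun i => (⟨evenFam Q e i, evenFam_mem e i⟩ : EvenSpace Q))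
    (LinearIndependent.of_comp (Subalgebra.toSubmodule (even Q)).subtype
      (linearIndependent_evenFam he)) (by
    rintro ⟨x, hx⟩ -
    obtain ⟨c, rfl⟩ := (mem_even_iff e).1 hx
    have : (⟨∑ i, c i • evenFam Q e i, hx⟩ : EvenSpace Q) =
        ∑ i, c i • (⟨evenFam Q e i, evenFam_mem e i⟩ : EvenSpace Q) := by
      refine Subtype.ext ?_
      rw [AddSubmonoidClass.coe_finsetSum]
      rfl
    rw [this]
    exact Submodule.sum_mem _ fun i _ => Submodule.smul_mem _ _ (Submodule.subset_span ⟨i, rfl⟩))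

theorem coe_evenBasis {e : Basis (Fin 3) F W} (he : halfDisc Q e ≠ 0) (i : Fin 4) :
    (evenBasis he i : CliffordAlgebra Q) = evenFam Q e i := by
  rw [evenBasis, Basis.mk_apply]

theorem gram2_evenBasis {e : Basis (Fin 3) F W} (he : halfDisc Q e ≠ 0) :
    gram2 (normForm Q) (evenBasis he) = evenGram Q e := by
  ext i j
  simp only [gram2, Matrix.of_apply]
  rw [two_mul_normForm, coe_evenBasis, coe_evenBasis, normTrace_evenFam, scalarPart_smul_one]

end NormForm

section Discriminant

variable {R F : Type*} [CommRing R] [IsDedekindDomain R] [Field F] [Algebra R F]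
  [IsFractionRing R F] [CharZero F]
variable {W : Type*} [AddCommGroup W] [Module F W] [Module R W] [IsScalarTower R F W]
variable {Q : QuadraticForm F W}

variable (Q) in
/-- Restriction of a submodule of the Clifford algebra to the even part. -/
def evenComap (o : Submodule R (CliffordAlgebra Q)) : Submodule R (EvenSpace Q) :=
  Submodule.comap ((Subalgebra.toSubmodule (even Q)).subtype.restrictScalars R) o

theorem mem_evenComap {o : Submodule R (CliffordAlgebra Q)} {x : EvenSpace Q} :
    x ∈ evenComap Q o ↔ (x : CliffordAlgebra Q) ∈ o := Iff.rfl

theorem map_evenComap {o : Submodule R (CliffordAlgebra Q)} (ho : ∀ x ∈ o, x ∈ even Q) :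
    Submodule.map ((Subalgebra.toSubmodule (even Q)).subtype.restrictScalars R)
      (evenComap Q o) = o := by
  ext x
  constructor
  · rintro ⟨y, hy, rfl⟩
    exact hy
  · exact fun hx => ⟨⟨x, ho x hx⟩, hx, rfl⟩

theorem localAt_evenComap (v : HeightOneSpectrum R) (o : Submodule R (CliffordAlgebra Q)) :
    localAt R _ v (evenComap Q o) = evenComap Q (localAt R _ v o) := rfl

theorem evenComap_coordSpan {S : Subalgebra R F} {e : Basis (Fin 3) F W}
    (he : halfDisc Q e ≠ 0) :
    evenComap Q (coordSpan S (evenFam Q e)) = coordSpan S (evenBasis he) := by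
  have h := map_coordSpan (S := S) (Subalgebra.toSubmodule (even Q)).subtype (evenBasis he)
  simp only [Submodule.subtype_apply, coe_evenBasis] at h
  rw [← h]
  exact Submodule.comap_map_eq_of_injective (Subtype.val_injective) _

theorem evenComap_normDual (e : Basis (Fin 3) F W) {o : Submodule R (CliffordAlgebra Q)}
    (ho : ∀ x ∈ o, x ∈ even Q) :
    evenComap Q (normDual R F W Q o) = dualLat R F (EvenSpace Q) (normForm Q) (evenComap Q o) := by
  have key : ∀ x y : EvenSpace Q, traceMap R F W Q (y : CliffordAlgebra Q) x ∈ oneLat R F W Q ↔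
      2 * normForm Q x y ∈ (algebraMap R F).range := by
    intro x y
    have h1 : traceMap R F W Q (y : CliffordAlgebra Q) x = normTrace Q x y := rfl
    rw [two_mul_normForm, h1]
    have h2 := normTrace_eq_smul_one e x.2 y.2
    constructor
    · rintro ⟨r, hr⟩
      refine ⟨r, ?_⟩
      rw [← hr, Algebra.linearMap_apply, Algebra.algebraMap_eq_smul_one (A := CliffordAlgebra Q),
        ← algebraMap_smul F, scalarPart_smul_one]
    · rintro ⟨r, hr⟩
      refine ⟨r, ?_⟩
      rw [h2, ← hr, algebraMap_smul, Algebra.linearMap_apply, Algebra.algebraMap_eq_smul_one]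
  ext x
  rw [mem_dualLat, mem_evenComap, normDual, Submodule.mem_inf]
  simp only [Submodule.mem_iInf, Submodule.mem_comap]
  constructor
  · rintro ⟨-, h⟩ y hy
    exact (key x y).1 (h y hy)
  · intro h
    exact ⟨x.2, fun y hy => (key x ⟨y, ho y hy⟩).2 (h _ hy)⟩

theorem APlusSub_le_even {N : Submodule R W} : ∀ x ∈ APlusSub R F W Q N, x ∈ even Q :=
  fun _ hx => hx.1

/-- A submodule of the even Clifford algebra on which the norm form is locally integral is
finitely generated. -/
theorem fg_evenComap (hR : ¬ IsField R) {e : Basis (Fin 3) F W} (he : halfDisc Q e ≠ 0)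
    {o : Submodule R (CliffordAlgebra Q)}
    (h_int : ∀ v : HeightOneSpectrum R, ∀ x ∈ o, ∀ y ∈ o, ∃ s ∈ locRing R F v,
      normTrace Q x y = s • 1)
    (hspan : ∀ i, ∃ r : R, r ≠ 0 ∧ r • evenFam Q e i ∈ o) : (evenComap Q o).FG := by
  choose r hr hro using hspan
  have hG : (gram2 (normForm Q) (evenBasis he)).det ≠ 0 := by
    rw [gram2_evenBasis, det_evenGram]
    exact pow_ne_zero 2 he
  have hs : ∏ i, r i ≠ 0 := Finset.prod_ne_zero_iff.2 fun i _ => hr i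
  refine fg_of_forall_mem_range hG hs fun x hx i => ?_
  have hio : (((∏ i, r i) • evenBasis he i : EvenSpace Q) : CliffordAlgebra Q) ∈ o := by
    rw [← Finset.prod_erase_mul _ _ (Finset.mem_univ i), mul_smul]
    have : ((r i • evenBasis he i : EvenSpace Q) : CliffordAlgebra Q) ∈ o := by
      have := hro i
      rw [← coe_evenBasis he] at this
      exact this
    exact o.smul_mem _ this
  change _ ∈ LinearMap.range (Algebra.linearMap R F)
  refine mem_of_forall_mem_localAt hR fun v => ?_
  obtain ⟨s, hs, hxs⟩ := h_int v (x : CliffordAlgebra Q) hx _ hio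
  rw [two_mul_normForm, hxs, scalarPart_smul_one]
  obtain ⟨t, ht, a, ha⟩ := mem_locRing.1 hs
  exact ⟨t, ht, a, ha⟩

/-- `Q` is integral on `N`. -/
def QuadIntegral (Q : QuadraticForm F W) (N : Submodule R W) : Prop :=
  ∀ x ∈ N, Q x ∈ (algebraMap R F).range

theorem QuadIntegral.famIntegral {N : Submodule R W} (hN : QuadIntegral Q N)
    {v : HeightOneSpectrum R} {e : Fin 3 → W} (he : ∀ i, e i ∈ localAt R W v N) :
    FamIntegral (locRing R F v) Q e := by
  have key : ∀ x ∈ localAt R W v N, Q x ∈ locRing R F v := by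
    rintro x ⟨s, hs, hx⟩
    obtain ⟨a, ha⟩ := hN _ hx
    refine ⟨s * s, mul_notMem_asIdeal hs hs, a, ?_⟩
    rw [ha, ← algebraMap_smul F s x, QuadraticMap.map_smul, smul_eq_mul, Algebra.smul_def, map_mul]
  refine ⟨fun i => key _ (he i), fun i j => ?_⟩
  exact sub_mem (sub_mem (key _ (Submodule.add_mem _ (he i) (he j))) (key _ (he i))) (key _ (he j))

theorem span_APlusSub {N : Submodule R W} {v : HeightOneSpectrum R} {e : Fin 3 → W}
    (he : FamIntegral (locRing R F v) Q e)
    (hNe : localAt R W v N = coordSpan (locRing R F v) e) (i : Fin 4) :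
    ∃ r : R, r ≠ 0 ∧ r • evenFam Q e i ∈ APlusSub R F W Q N := by
  have : evenFam Q e i ∈ localAt R _ v (APlusSub R F W Q N) := by
    rw [localAt_APlusSub he hNe]
    exact self_mem_coordSpan (evenFam Q e) i
  obtain ⟨r, hr, h⟩ := this
  exact ⟨r, ne_zero_of_notMem_asIdeal hr, h⟩

theorem normTrace_mem_of_localAt (hW : finrank F W = 3) [Module.Finite F W] {N : Submodule R W}
    (hN : IsLat R F W N) (hQ : QuadIntegral Q N) (v : HeightOneSpectrum R)
    {x y : CliffordAlgebra Q} (hx : x ∈ localAt R _ v (APlusSub R F W Q N))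
    (hy : y ∈ localAt R _ v (APlusSub R F W Q N)) :
    ∃ s ∈ locRing R F v, normTrace Q x y = s • 1 := by
  obtain ⟨e, he⟩ := exists_basis_localAt v hW hN
  have h_int : FamIntegral (locRing R F v) Q e :=
    hQ.famIntegral (v := v) fun i => he ▸ self_mem_coordSpan e i
  rw [localAt_APlusSub h_int he] at hx hy
  exact normTrace_mem_of_coordSpan h_int hx hy

/-- Local generator of the discriminant of the even Clifford order. -/
theorem locGen_latIdx_normDual (hR : ¬ IsField R) [Module.Finite F W] {N : Submodule R W}
    (hN : IsLat R F W N) (hQ : QuadIntegral Q N) {v : HeightOneSpectrum R}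
    {e : Basis (Fin 3) F W} (he : halfDisc Q e ≠ 0)
    (hNe : localAt R W v N = coordSpan (locRing R F v) e) :
    LocGen v (latIdxIn R F (CliffordAlgebra Q) (Subalgebra.toSubmodule (even Q))
      (normDual R F W Q (APlusSub R F W Q N)) (APlusSub R F W Q N)) (halfDisc Q e ^ 2) := by
  have h_int : FamIntegral (locRing R F v) Q e :=
    hQ.famIntegral (v := v) fun i => hNe ▸ self_mem_coordSpan e i
  have hW : finrank F W = 3 := by rw [finrank_eq_card_basis e, Fintype.card_fin]
  have hG : (gram2 (normForm Q) (evenBasis he)).det = halfDisc Q e ^ 2 := by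
    rw [gram2_evenBasis, det_evenGram]
  have hfg : (evenComap Q (APlusSub R F W Q N)).FG :=
    fg_evenComap hR he (fun v x hx y hy => normTrace_mem_of_localAt hW hN hQ v
      (le_localAt v _ hx) (le_localAt v _ hy)) (span_APlusSub h_int hNe)
  have hloc : localAt R _ v (evenComap Q (APlusSub R F W Q N)) =
      coordSpan (locRing R F v) (evenBasis he) := by
    rw [localAt_evenComap, localAt_APlusSub h_int hNe, evenComap_coordSpan]
  have := locGen_latIdx_dualLat (B := normForm Q) (b := evenBasis he)
    (by rw [hG]; exact pow_ne_zero 2 he) hfg hloc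
  rw [hG, ← evenComap_normDual e APlusSub_le_even] at this
  exact this

end Discriminant

section Volume

variable {F : Type*} [Field F] {W : Type*} [AddCommGroup W] [Module F W]
variable {Q : QuadraticForm F W}

variable (Q) in
/-- The trilinear map `(x, y, z) ↦ xyz - zyx`. -/
noncomputable def volMulti : MultilinearMap F (fun _ : Fin 3 => W) (CliffordAlgebra Q) :=
  (LinearMap.id - reverse : CliffordAlgebra Q →ₗ[F] CliffordAlgebra Q).compMultilinearMap
    ((MultilinearMap.mkPiAlgebraFin F 3 (CliffordAlgebra Q)).compLinearMap fun _ => ι Q)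

theorem volMulti_apply (f : Fin 3 → W) : volMulti Q f =
    ι Q (f 0) * (ι Q (f 1) * ι Q (f 2)) - ι Q (f 2) * (ι Q (f 1) * ι Q (f 0)) := by
  simp [volMulti, List.ofFn_succ, mul_assoc]

variable (Q) in
/-- The alternating map `(x, y, z) ↦ xyz - zyx`. -/
noncomputable def vol : W [⋀^Fin 3]→ₗ[F] CliffordAlgebra Q :=
  { volMulti Q with
    map_eq_zero_of_eq' := by
      intro f i j hf hij
      change volMulti Q f = 0
      rw [volMulti_apply]
      have hz : ∀ x y : W, ι Q x * (ι Q x * ι Q y) = ι Q y * (ι Q x * ι Q x) := by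
        intro x y
        rw [ι_mul_self_mul, ι_mul_self, mul_smul_comm, mul_one]
      fin_cases i <;> fin_cases j <;> simp at hij hf <;> simp only [hf] <;>
      first
      | exact sub_eq_zero.2 (hz _ _)
      | exact sub_eq_zero.2 (hz _ _).symm
      | exact sub_self _ }

theorem vol_apply (f : Fin 3 → W) : vol Q f =
    ι Q (f 0) * (ι Q (f 1) * ι Q (f 2)) - ι Q (f 2) * (ι Q (f 1) * ι Q (f 0)) :=
  volMulti_apply f

theorem vol_eq_det_smul (e : Basis (Fin 3) F W) (f : Fin 3 → W) :
    vol Q f = e.det f • vol Q e := by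
  suffices vol Q = (LinearMap.toSpanSingleton F _ (vol Q e)).compAlternatingMap e.det by
    conv_lhs => rw [this]
    simp
  refine e.ext_alternating fun v hv => ?_
  obtain ⟨σ, rfl⟩ : ∃ σ : Equiv.Perm (Fin 3), ⇑σ = v :=
    ⟨Equiv.ofBijective v (Finite.injective_iff_bijective.1 hv), rfl⟩
  change vol Q (e ∘ σ) =
    (LinearMap.toSpanSingleton F _ (vol Q e)).compAlternatingMap e.det (e ∘ σ)
  rw [AlternatingMap.map_perm (vol Q) (⇑e) σ, AlternatingMap.map_perm _ (⇑e) σ]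
  simp [Basis.det_self]

theorem vol_comp (e : Basis (Fin 3) F W) (γ : W →ₗ[F] W) :
    vol Q (fun i => γ (e i)) = LinearMap.det γ • vol Q e := by
  rw [vol_eq_det_smul e]
  congr 1
  have := e.det_comp γ e
  rw [Basis.det_self, mul_one] at this
  exact this

theorem vol_mul_self (e : Fin 3 → W) : vol Q e * vol Q e = (-halfDisc Q e) • 1 := by
  have r01 := ι_swap (Q := Q) (e 0) (e 1)
  have r02 := ι_swap (Q := Q) (e 0) (e 2)
  have r12 := ι_swap (Q := Q) (e 1) (e 2)
  have t01 := ι_swap_mul (Q := Q) (e 0) (e 1)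
  have t02 := ι_swap_mul (Q := Q) (e 0) (e 2)
  have t12 := ι_swap_mul (Q := Q) (e 1) (e 2)
  rw [vol_apply]
  simp only [halfDisc, mul_assoc, r01, r02, r12, t01, t02, t12, ι_mul_self, ι_mul_self_mul,
      mul_sub, sub_mul, smul_sub, mul_smul_comm, smul_mul_assoc, mul_one]
  module

theorem ι_mul_vol_basis (e : Fin 3 → W) (i : Fin 3) :
    ι Q (e i) * vol Q e = vol Q e * ι Q (e i) := by
  have r01 := ι_swap (Q := Q) (e 0) (e 1)
  have r02 := ι_swap (Q := Q) (e 0) (e 2)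
  have r12 := ι_swap (Q := Q) (e 1) (e 2)
  have t01 := ι_swap_mul (Q := Q) (e 0) (e 1)
  have t02 := ι_swap_mul (Q := Q) (e 0) (e 2)
  have t12 := ι_swap_mul (Q := Q) (e 1) (e 2)
  rw [vol_apply]
  fin_cases i <;>
  · simp only [Fin.zero_eta, Fin.mk_one, Fin.reduceFinMk,
      mul_assoc, r01, r02, r12, t01, t02, t12, ι_mul_self, ι_mul_self_mul,
      mul_sub, sub_mul, smul_sub, mul_smul_comm, smul_mul_assoc, mul_one]
    module

theorem mul_vol (e : Basis (Fin 3) F W) (x : CliffordAlgebra Q) :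
    x * vol Q e = vol Q e * x := by
  induction x using CliffordAlgebra.induction with
  | algebraMap r => exact Algebra.commutes r _
  | ι w =>
    rw [← e.sum_repr w, map_sum, Finset.sum_mul, Finset.mul_sum]
    refine Finset.sum_congr rfl fun i _ => ?_
    rw [map_smul, smul_mul_assoc, mul_smul_comm, ι_mul_vol_basis]
  | mul a b ha hb => rw [mul_assoc, hb, ← mul_assoc, ha, mul_assoc]
  | add a b ha hb => rw [add_mul, mul_add, ha, hb]

theorem vol_mem_odd (e : Fin 3 → W) : vol Q e ∈ evenOdd Q 1 := by
  rw [vol_apply]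
  exact sub_mem
    (mul_mem_evenOdd_one (ι_mem_evenOdd_one Q _) (ι_mul_ι_mem_evenOdd_zero Q _ _))
    (mul_mem_evenOdd_one (ι_mem_evenOdd_one Q _) (ι_mul_ι_mem_evenOdd_zero Q _ _))

theorem mul_mem_even_of_odd {x y : CliffordAlgebra Q} (hx : x ∈ evenOdd Q 1)
    (hy : y ∈ evenOdd Q 1) : x * y ∈ even Q := by
  have := SetLike.mul_mem_graded hx hy
  rwa [show (1 + 1 : ZMod 2) = 0 by decide] at this

variable [CharZero F]

theorem vol_ne_zero {e : Fin 3 → W} (he : halfDisc Q e ≠ 0) : vol Q e ≠ 0 := by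
  intro h
  have := vol_mul_self (Q := Q) e
  rw [h, mul_zero, ← zero_smul F (1 : CliffordAlgebra Q)] at this
  exact he (neg_eq_zero.1 (smul_one_injective this).symm)

theorem halfDisc_ne_zero {e : Basis (Fin 3) F W} (he : halfDisc Q e ≠ 0)
    (f : Basis (Fin 3) F W) : halfDisc Q f ≠ 0 := by
  have h : (-halfDisc Q f) • (1 : CliffordAlgebra Q) =
      (e.det f * (e.det f * -halfDisc Q e)) • 1 := by
    rw [← vol_mul_self, vol_eq_det_smul e f, smul_mul_smul_comm, vol_mul_self, smul_smul, mul_assoc]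
  have h := smul_one_injective h
  have hdet : e.det f ≠ 0 := (e.isUnit_det f).ne_zero
  intro h0
  rw [h0, neg_zero] at h
  exact mul_ne_zero hdet (mul_ne_zero hdet (neg_ne_zero.2 he)) h.symm

/-- The test elements `e₁e₂, e₂e₀, e₀e₁`. -/
def pairFam (Q : QuadraticForm F W) (e : Fin 3 → W) (i : Fin 3) : CliffordAlgebra Q :=
  evenFam Q e i.succ

theorem ι_mul_pairFam (e : Basis (Fin 3) F W) (w : W) (i : Fin 3) :
    ι Q w * pairFam Q e i - reverse (pairFam Q e i) * ι Q w = e.repr w i • vol Q e := by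
  have h : ∀ x y : W, ι Q w * (ι Q x * ι Q y) - reverse (ι Q x * ι Q y) * ι Q w =
      vol Q ![w, x, y] := by
    intro x y
    simp [vol_apply, mul_assoc]
  fin_cases i
  · change ι Q w * (ι Q (e 1) * ι Q (e 2)) - reverse (ι Q (e 1) * ι Q (e 2)) * ι Q w = _
    rw [h, vol_eq_det_smul e]
    congr 1
    simp [Basis.det_apply, Matrix.det_fin_three, Basis.toMatrix_apply]
  · change ι Q w * (ι Q (e 2) * ι Q (e 0)) - reverse (ι Q (e 2) * ι Q (e 0)) * ι Q w = _
    rw [h, vol_eq_det_smul e]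
    congr 1
    simp [Basis.det_apply, Matrix.det_fin_three, Basis.toMatrix_apply]
  · change ι Q w * (ι Q (e 0) * ι Q (e 1)) - reverse (ι Q (e 0) * ι Q (e 1)) * ι Q w = _
    rw [h, vol_eq_det_smul e]
    congr 1
    simp [Basis.det_apply, Matrix.det_fin_three, Basis.toMatrix_apply]

theorem ι_injective_of_halfDisc {e : Basis (Fin 3) F W} (he : halfDisc Q e ≠ 0) :
    Function.Injective (ι Q) := by
  rw [injective_iff_map_eq_zero]
  intro w hw
  refine e.repr.injective (Finsupp.ext fun i => ?_)
  have := ι_mul_pairFam (Q := Q) e w i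
  rw [hw, zero_mul, mul_zero, sub_zero] at this
  simpa using (smul_eq_zero.1 this.symm).resolve_right (vol_ne_zero he)

/-- An odd element of the Clifford algebra fixed by reversal is a vector. -/
theorem exists_eq_ι_of_odd {e : Basis (Fin 3) F W} (he : halfDisc Q e ≠ 0)
    {x : CliffordAlgebra Q} (hx : x ∈ evenOdd Q 1) (hr : reverse x = x) : ∃ w, ι Q w = x := by
  obtain ⟨c, rfl⟩ := exists_eq_sum_oddFam e hx
  have h3 : c 3 • vol Q e = 0 := by
    rw [eq_comm, ← sub_eq_zero] at hr
    rw [← hr, vol_apply]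
    simp only [oddFam, Fin.sum_univ_four, Matrix.cons_val_zero, Matrix.cons_val_one,
      Matrix.cons_val, map_add, map_smul, reverse_ι, reverse.map_mul, mul_assoc]
    module
  have h3 := (smul_eq_zero.1 h3).resolve_right (vol_ne_zero he)
  refine ⟨c 0 • e 0 + c 1 • e 1 + c 2 • e 2, ?_⟩
  simp [Fin.sum_univ_four, h3, oddFam]

theorem isGPlusUnit_inv {α : (CliffordAlgebra Q)ˣ} (h : IsGPlusUnit F W Q α) :
    IsGPlusUnit F W Q α⁻¹ := ⟨h.2, by rw [inv_inv]; exact h.1⟩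

theorem exists_reverse_eq_smul {e : Basis (Fin 3) F W} {α : (CliffordAlgebra Q)ˣ}
    (h : IsGPlusUnit F W Q α) : ∃ n : F, n ≠ 0 ∧
      reverse (α : CliffordAlgebra Q) = n • ((α⁻¹ : (CliffordAlgebra Q)ˣ) : CliffordAlgebra Q) := by
  have : Nontrivial (CliffordAlgebra Q) := nontrivial_cliffordAlgebra
  have h2 : (2 : F) ≠ 0 := two_ne_zero
  set s := scalarPart Q (normTrace Q (α : CliffordAlgebra Q) α) with hs
  have h1 : (α : CliffordAlgebra Q) * reverse (α : CliffordAlgebra Q) = (2⁻¹ * s) • 1 := by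
    have := normTrace_eq_smul_one e h.1 h.1
    rw [← hs, normTrace_apply, ← two_smul F] at this
    rw [mul_smul, ← this, smul_smul, inv_mul_cancel₀ h2, one_smul]
  have h3 : reverse (α : CliffordAlgebra Q) =
      (2⁻¹ * s) • ((α⁻¹ : (CliffordAlgebra Q)ˣ) : CliffordAlgebra Q) := by
    have := congrArg (fun x => ((α⁻¹ : (CliffordAlgebra Q)ˣ) : CliffordAlgebra Q) * x) h1
    simpa [← mul_assoc] using this
  refine ⟨_, fun h0 => ?_, h3⟩
  rw [h0, zero_smul] at h3
  exact α.ne_zero (by rw [← reverse_reverse (α : CliffordAlgebra Q), h3, map_zero])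

theorem exists_linearMap_conj {e : Basis (Fin 3) F W} (he : halfDisc Q e ≠ 0)
    {α : (CliffordAlgebra Q)ˣ} (h : IsGPlusUnit F W Q α) : ∃ f : W →ₗ[F] W, ∀ x : W,
      ι Q (f x) = ((α⁻¹ : (CliffordAlgebra Q)ˣ) : CliffordAlgebra Q) * ι Q x * α := by
  have key : ∀ x : W, ∃ y : W,
      ι Q y = ((α⁻¹ : (CliffordAlgebra Q)ˣ) : CliffordAlgebra Q) * ι Q x * α := by
    intro x
    refine exists_eq_ι_of_odd he ?_ ?_
    · refine mul_mem_evenOdd_one ?_ h.1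
      have := SetLike.mul_mem_graded (show _ ∈ evenOdd Q 0 from h.2) (ι_mem_evenOdd_one Q x)
      rwa [zero_add] at this
    · obtain ⟨n, hn, hα⟩ := exists_reverse_eq_smul (e := e) h
      have hα' : reverse ((α⁻¹ : (CliffordAlgebra Q)ˣ) : CliffordAlgebra Q) =
          n⁻¹ • (α : CliffordAlgebra Q) := by
        have := congrArg (fun x => n⁻¹ • reverse x) hα
        simp only [reverse_reverse, map_smul, smul_smul, inv_mul_cancel₀ hn, one_smul] at this
        exact this.symm
      rw [reverse.map_mul, reverse.map_mul, hα, hα', reverse_ι, mul_smul_comm, smul_mul_smul_comm,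
        mul_inv_cancel₀ hn, one_smul, mul_assoc]
  choose f hf using key
  have hinj := ι_injective_of_halfDisc he
  exact ⟨{ toFun := f
           map_add' := fun x y => hinj (by simp only [hf, map_add, mul_add, add_mul])
           map_smul' := fun c x => hinj (by
            simp only [hf, map_smul, mul_smul_comm, smul_mul_assoc, RingHom.id_apply]) }, hf⟩

/-- Units of the even Clifford algebra act on `W` by proper isometries. -/
theorem exists_isTau {e : Basis (Fin 3) F W} (he : halfDisc Q e ≠ 0)
    {α : (CliffordAlgebra Q)ˣ} (h : IsGPlusUnit F W Q α) : ∃ γ : W ≃ₗ[F] W,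
      IsTau F W Q γ α ∧ (∀ x, Q (γ x) = Q x) ∧ LinearMap.det (γ : W →ₗ[F] W) = 1 := by
  have hinj := ι_injective_of_halfDisc he
  obtain ⟨f, hf⟩ := exists_linearMap_conj he h
  obtain ⟨g, hg⟩ := exists_linearMap_conj he (isGPlusUnit_inv h)
  have hfg : f ∘ₗ g = LinearMap.id := LinearMap.ext fun x => hinj (by
    rw [LinearMap.comp_apply, hf, hg]
    simp [mul_assoc])
  have hgf : g ∘ₗ f = LinearMap.id := LinearMap.ext fun x => hinj (by
    rw [LinearMap.comp_apply, hg, hf]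
    simp [mul_assoc])
  refine ⟨LinearEquiv.ofLinearMap f g hfg hgf, hf, fun x => ?_, ?_⟩
  · refine smul_one_injective (Q := Q) ?_
    rw [← ι_mul_self, ← ι_mul_self]
    change ι Q (f x) * ι Q (f x) = _
    rw [hf, show ∀ a b c : CliffordAlgebra Q, a * b * c * (a * b * c) = a * (b * (c * a) * b) * c by
      intros; simp only [mul_assoc], Units.mul_inv, mul_one, ι_mul_self]
    simp
  · have h1 : vol Q (fun i => f (e i)) = vol Q e := by
      have : vol Q (fun i => f (e i)) =
          ((α⁻¹ : (CliffordAlgebra Q)ˣ) : CliffordAlgebra Q) * vol Q e * α := by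
        rw [vol_apply, vol_apply, mul_sub, sub_mul]
        simp only [hf]
        simp [mul_assoc]
      rw [this, mul_vol, mul_assoc, Units.inv_mul, mul_one]
    rw [vol_comp] at h1
    have h2 : (LinearMap.det f - 1) • vol Q e = 0 := by rw [sub_smul, h1, one_smul, sub_self]
    exact sub_eq_zero.1 ((smul_eq_zero.1 h2).resolve_right (vol_ne_zero he))

end Volume

section Isometries

variable {F : Type*} [Field F] {W : Type*} [AddCommGroup W] [Module F W]
variable {Q : QuadraticForm F W}

variable (Q) in
/-- The isometries which are, up to sign, induced by a unit of the even Clifford algebra. -/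
def conjSubgroup : Subgroup (W ≃ₗ[F] W) where
  carrier := {γ | ∃ α : (CliffordAlgebra Q)ˣ, IsGPlusUnit F W Q α ∧ ∃ ε : F, ε * ε = 1 ∧
    ∀ x, ι Q (γ x) =
      ε • (((α⁻¹ : (CliffordAlgebra Q)ˣ) : CliffordAlgebra Q) * (ι Q x * (α : CliffordAlgebra Q)))}
  one_mem' := ⟨1, ⟨(even Q).one_mem, by rw [inv_one]; exact (even Q).one_mem⟩, 1, one_mul 1,
    fun x => by simp⟩
  mul_mem' := by
    rintro γ δ ⟨α, hα, ε, hε, hγ⟩ ⟨β, hβ, η, hη, hδ⟩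
    refine ⟨β * α, ⟨mul_mem hβ.1 hα.1, by rw [mul_inv_rev]; exact mul_mem hα.2 hβ.2⟩, ε * η,
      by rw [mul_mul_mul_comm, hε, hη, one_mul], fun x => ?_⟩
    rw [LinearEquiv.mul_apply, hγ, hδ, mul_inv_rev]
    simp only [Units.val_mul, mul_assoc, smul_mul_assoc, mul_smul_comm, smul_smul]
  inv_mem' := by
    rintro γ ⟨α, hα, ε, hε, hγ⟩
    refine ⟨α⁻¹, ⟨hα.2, by rw [inv_inv]; exact hα.1⟩, ε, hε, fun x => ?_⟩
    obtain ⟨z, rfl⟩ := γ.surjective x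
    rw [hγ]
    have : γ⁻¹ (γ z) = z := γ.symm_apply_apply z
    simp [this, mul_assoc, smul_smul, hε]

/-- The symmetry along an anisotropic vector. -/
noncomputable def reflection (a : W) (ha : Q a ≠ 0) : W ≃ₗ[F] W :=
  Module.reflection (x := a) (f := (Q a)⁻¹ • QuadraticMap.polarBilin Q a) (by
    rw [LinearMap.smul_apply, QuadraticMap.polarBilin_apply_apply, QuadraticMap.polar_self,
      smul_eq_mul, nsmul_eq_mul, mul_left_comm, inv_mul_cancel₀ ha]
    norm_num)

theorem reflection_apply (a : W) (ha : Q a ≠ 0) (x : W) :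
    reflection a ha x = x - ((Q a)⁻¹ * QuadraticMap.polar Q a x) • a := by
  simp [reflection, Module.reflection_apply]

theorem quad_sub (x y : W) : Q (x - y) = Q x + Q y - QuadraticMap.polar Q x y := by
  have := QuadraticMap.polar_neg_right Q x y
  rw [QuadraticMap.polar, QuadraticMap.map_neg, ← sub_eq_add_neg] at this
  linear_combination this

theorem quad_add (x y : W) : Q (x + y) = Q x + Q y + QuadraticMap.polar Q x y := by
  rw [QuadraticMap.polar]
  ring

theorem quad_reflection (a : W) (ha : Q a ≠ 0) (x : W) : Q (reflection a ha x) = Q x := by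
  rw [reflection_apply, quad_sub, QuadraticMap.map_smul, QuadraticMap.polar_smul_right, smul_eq_mul,
    smul_eq_mul, QuadraticMap.polar_comm Q x a]
  field_simp
  ring

theorem reflection_apply_of_polar_eq_zero {a : W} (ha : Q a ≠ 0) {x : W}
    (h : QuadraticMap.polar Q a x = 0) : reflection a ha x = x := by
  rw [reflection_apply, h, mul_zero, zero_smul, sub_zero]

/-- The symmetry along `y - u` exchanges the equal-length vectors `y` and `u`. -/
theorem reflection_sub {y u : W} (hyu : Q y = Q u) (ha : Q (y - u) ≠ 0) :
    reflection (y - u) ha y = u := by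
  have h : QuadraticMap.polar Q (y - u) y = Q (y - u) := by
    rw [QuadraticMap.polar_sub_left, QuadraticMap.polar_self, quad_sub, hyu,
      QuadraticMap.polar_comm Q u y, nsmul_eq_mul]
    push_cast
    ring
  rw [reflection_apply, h, inv_mul_cancel₀ ha, one_smul, sub_sub_cancel]

variable [CharZero F]

theorem reflection_mem_conjSubgroup {e : Basis (Fin 3) F W} (he : halfDisc Q e ≠ 0) (a : W)
    (ha : Q a ≠ 0) : reflection a ha ∈ conjSubgroup Q := by
  set k := Q a * -halfDisc Q e with hk
  have hk0 : k ≠ 0 := mul_ne_zero ha (neg_ne_zero.2 he)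
  set g := ι Q a * vol Q e with hg
  have hgg : g * g = k • 1 := by
    rw [hg, hk, mul_assoc, ← mul_assoc (vol Q e), ← mul_vol, mul_assoc, ι_mul_self_mul,
      vol_mul_self, smul_smul]
  have hge : g ∈ even Q := mul_mem_even_of_odd (ι_mem_evenOdd_one Q a) (vol_mem_odd e)
  refine ⟨⟨g, k⁻¹ • g, by rw [mul_smul_comm, hgg, smul_smul, inv_mul_cancel₀ hk0, one_smul],
    by rw [smul_mul_assoc, hgg, smul_smul, inv_mul_cancel₀ hk0, one_smul]⟩,
    ⟨hge, (even Q).smul_mem hge _⟩, -1, by norm_num, fun x => ?_⟩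
  change _ = (-1 : F) • ((k⁻¹ • g) * (ι Q x * g))
  have h1 : g * (ι Q x * g) = (-halfDisc Q e) • (ι Q a * (ι Q x * ι Q a)) := by
    rw [hg]
    have : ι Q a * vol Q e * (ι Q x * (ι Q a * vol Q e)) =
        ι Q a * (ι Q x * (ι Q a * (vol Q e * vol Q e))) := by
      rw [mul_assoc, ← mul_vol]
      simp only [mul_assoc]
    rw [this, vol_mul_self]
    simp only [mul_smul_comm, mul_one]
  rw [smul_mul_assoc, h1, ι_swap, mul_sub, ι_mul_self_mul, mul_smul_comm, mul_one, reflection_apply,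
    map_sub, map_smul, hk]
  have h2 : halfDisc Q e ≠ 0 := he
  match_scalars <;> field_simp

theorem exists_fix {e : Basis (Fin 3) F W} (he : halfDisc Q e ≠ 0) {y u : W}
    (hyu : Q y = Q u) (hu : Q u ≠ 0) : ∃ ρ ∈ conjSubgroup Q, (∀ x, Q (ρ x) = Q x) ∧ ρ y = u ∧
      ∀ x, QuadraticMap.polar Q y x = 0 → QuadraticMap.polar Q u x = 0 → ρ x = x := by
  by_cases h : Q (y - u) = 0
  · have h' : Q (y - -u) ≠ 0 := by
      intro h'
      rw [sub_neg_eq_add, quad_add, hyu] at h'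
      rw [quad_sub, hyu] at h
      have : (4 : F) * Q u = 0 := by linear_combination h + h'
      exact hu ((mul_eq_zero.1 this).resolve_left (by norm_num))
    have hyu' : Q y = Q (-u) := by rw [hyu, QuadraticMap.map_neg]
    refine ⟨reflection u hu * reflection (y - -u) h', mul_mem (reflection_mem_conjSubgroup he _ _)
      (reflection_mem_conjSubgroup he _ _), fun x => ?_, ?_, fun x h1 h2 => ?_⟩
    · rw [LinearEquiv.mul_apply, quad_reflection, quad_reflection]
    · rw [LinearEquiv.mul_apply, reflection_sub hyu', reflection_apply,
        QuadraticMap.polar_neg_right,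
        QuadraticMap.polar_self]
      simp only [nsmul_eq_mul]
      match_scalars
      field_simp
      ring
    · rw [LinearEquiv.mul_apply, reflection_apply_of_polar_eq_zero (a := y - -u),
        reflection_apply_of_polar_eq_zero hu h2]
      rw [sub_neg_eq_add, QuadraticMap.polar_add_left, h1, h2, add_zero]
  · refine ⟨reflection (y - u) h, reflection_mem_conjSubgroup he _ _, quad_reflection _ _,
      reflection_sub hyu h,
      fun x h1 h2 => reflection_apply_of_polar_eq_zero h ?_⟩
    rw [QuadraticMap.polar_sub_left, h1, h2, sub_zero]

theorem mem_conjSubgroup {e : Basis (Fin 3) F W} (he : halfDisc Q e ≠ 0) {γ : W ≃ₗ[F] W}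
    (hγ : ∀ x, Q (γ x) = Q x) : γ ∈ conjSubgroup Q := by
  obtain ⟨b, hb⟩ : ∃ b : Basis (Fin 3) F W,
      ∀ i j, i ≠ j → QuadraticMap.polar Q (b i) (b j) = 0 := by
    have : Invertible (2 : F) := invertibleOfNonzero two_ne_zero
    have : Module.Finite F W := e.finiteDimensional_of_finite
    have hW : finrank F W = 3 := by rw [finrank_eq_card_basis e, Fintype.card_fin]
    obtain ⟨v, hv⟩ := LinearMap.BilinForm.exists_orthogonal_basis
      (B := QuadraticMap.polarBilin Q) ⟨fun x y => QuadraticMap.polar_comm Q x y⟩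
    refine ⟨v.reindex (finCongr hW), fun i j hij => ?_⟩
    simp only [Basis.reindex_apply]
    exact hv fun h => hij ((finCongr hW).symm.injective h)
  have hQb : ∀ i, Q (b i) ≠ 0 := by
    have := halfDisc_ne_zero he b
    intro i hi
    apply this
    fin_cases i <;> simp at hi <;> simp [halfDisc, hb, hi]
  have hp : ∀ δ : W ≃ₗ[F] W, (∀ x, Q (δ x) = Q x) → ∀ x y,
      QuadraticMap.polar Q (δ x) (δ y) = QuadraticMap.polar Q x y := by
    intro δ hδ x y
    simp only [QuadraticMap.polar, ← map_add, hδ]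
  have key : ∀ k : ℕ, k ≤ 3 → ∃ ρ ∈ conjSubgroup Q, (∀ x, Q (ρ x) = Q x) ∧
      ∀ i : Fin 3, (i : ℕ) < k → ρ (γ (b i)) = b i := by
    intro k
    induction k with
    | zero => exact fun _ => ⟨1, one_mem _, fun _ => rfl, fun i hi => absurd hi (by omega)⟩
    | succ k ih =>
      intro hk
      obtain ⟨ρ, hρ, hρQ, hρb⟩ := ih (by omega)
      obtain ⟨σ, hσ, hσQ, hσy, hσx⟩ := exists_fix he (y := ρ (γ (b ⟨k, hk⟩))) (u := b ⟨k, hk⟩)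
        (by rw [hρQ, hγ]) (hQb _)
      refine ⟨σ * ρ, mul_mem hσ hρ, fun x => by rw [LinearEquiv.mul_apply, hσQ, hρQ],
        fun i hi => ?_⟩
      rw [LinearEquiv.mul_apply]
      rcases Nat.lt_succ_iff_lt_or_eq.1 hi with hi | hi
      · have hne : (⟨k, hk⟩ : Fin 3) ≠ i := fun h => by
          rw [← h] at hi
          exact lt_irrefl _ hi
        have h0 : QuadraticMap.polar Q (ρ (γ (b ⟨k, hk⟩))) (ρ (γ (b i))) = 0 := by
          rw [hp ρ hρQ, hp γ hγ, hb _ _ hne]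
        rw [hρb i hi] at h0 ⊢
        exact hσx _ h0 (hb _ _ hne)
      · have : i = ⟨k, hk⟩ := Fin.ext hi
        rw [this, hσy]
  obtain ⟨ρ, hρ, -, hρb⟩ := key 3 le_rfl
  have : ρ * γ = 1 := by
    refine LinearEquiv.toLinearMap_injective (b.ext fun i => ?_)
    exact hρb i i.2
  rw [eq_inv_of_mul_eq_one_right this]
  exact inv_mem hρ

/-- Proper isometries of a ternary space are induced by units of the even Clifford algebra. -/
theorem exists_unit_isTau {e : Basis (Fin 3) F W} (he : halfDisc Q e ≠ 0) {γ : W ≃ₗ[F] W}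
    (hγ : ∀ x, Q (γ x) = Q x) (hdet : LinearMap.det (γ : W →ₗ[F] W) = 1) :
    ∃ α : (CliffordAlgebra Q)ˣ, IsGPlusUnit F W Q α ∧ IsTau F W Q γ α := by
  obtain ⟨α, hα, ε, hε, h⟩ := mem_conjSubgroup he hγ
  have h1 : vol Q (fun i => (γ : W →ₗ[F] W) (e i)) = ε • vol Q e := by
    have : vol Q (fun i => (γ : W →ₗ[F] W) (e i)) = (ε * ε * ε) •
        (((α⁻¹ : (CliffordAlgebra Q)ˣ) : CliffordAlgebra Q) * vol Q e * α) := by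
      rw [vol_apply, vol_apply, mul_sub, sub_mul, smul_sub]
      simp only [LinearEquiv.coe_coe, h]
      simp [mul_assoc, smul_smul]
    rw [this, hε, one_mul, mul_vol, mul_assoc, Units.inv_mul, mul_one]
  rw [vol_comp, hdet] at h1
  have h2 : (1 - ε) • vol Q e = 0 := by rw [sub_smul, h1, sub_self]
  have h3 := sub_eq_zero.1 ((smul_eq_zero.1 h2).resolve_right (vol_ne_zero he))
  refine ⟨α, hα, fun x => ?_⟩
  rw [h, ← h3, one_smul, mul_assoc]

end Isometries

section Conjugation

variable {R F : Type*} [CommRing R] [Field F] [Algebra R F]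
variable {W : Type*} [AddCommGroup W] [Module F W] [Module R W] [IsScalarTower R F W]
variable {Q : QuadraticForm F W}

theorem conjMap_apply (α : (CliffordAlgebra Q)ˣ) (x : CliffordAlgebra Q) :
    conjMap R F W Q α x = ((α⁻¹ : (CliffordAlgebra Q)ˣ) : CliffordAlgebra Q) * (x * α) := rfl

theorem map_conjMap_mul (α β : (CliffordAlgebra Q)ˣ) (o : Submodule R (CliffordAlgebra Q)) :
    Submodule.map (conjMap R F W Q (α * β)) o =
      Submodule.map (conjMap R F W Q β) (Submodule.map (conjMap R F W Q α) o) := by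
  rw [← Submodule.map_comp]
  congr 1
  ext x
  simp only [LinearMap.comp_apply, conjMap_apply, mul_inv_rev, Units.val_mul, mul_assoc]

theorem map_conjMap_one (o : Submodule R (CliffordAlgebra Q)) :
    Submodule.map (conjMap R F W Q 1) o = o := by
  have : conjMap R F W Q 1 = LinearMap.id := by
    ext x
    simp [conjMap_apply]
  rw [this, Submodule.map_id]

theorem map_conjMap_conjMap_inv (α : (CliffordAlgebra Q)ˣ)
    (o : Submodule R (CliffordAlgebra Q)) :
    Submodule.map (conjMap R F W Q α) (Submodule.map (conjMap R F W Q α⁻¹) o) = o := by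
  rw [← map_conjMap_mul, inv_mul_cancel, map_conjMap_one]

theorem latAction_one (N : Submodule R W) : latAction R F W 1 N = N :=
  Submodule.map_id N

theorem latAction_mul (γ δ : W ≃ₗ[F] W) (N : Submodule R W) :
    latAction R F W (γ * δ) N = latAction R F W γ (latAction R F W δ N) :=
  Submodule.map_comp ((δ : W →ₗ[F] W).restrictScalars R) ((γ : W →ₗ[F] W).restrictScalars R) N

theorem latAction_inv_latAction (γ : W ≃ₗ[F] W) (N : Submodule R W) :
    latAction R F W γ⁻¹ (latAction R F W γ N) = N := by
  rw [← latAction_mul, inv_mul_cancel, latAction_one]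

theorem IsTau.inv {γ : W ≃ₗ[F] W} {α : (CliffordAlgebra Q)ˣ} (h : IsTau F W Q γ α) :
    IsTau F W Q γ⁻¹ α⁻¹ := fun x => by
  obtain ⟨z, rfl⟩ := γ.surjective x
  have : γ⁻¹ (γ z) = z := γ.symm_apply_apply z
  rw [this, h z, inv_inv]
  simp [mul_assoc]

theorem IsTau.map_APlusSub_le {γ : W ≃ₗ[F] W} {α : (CliffordAlgebra Q)ˣ} (h : IsTau F W Q γ α)
    (hα : IsGPlusUnit F W Q α) (N : Submodule R W) :
    Submodule.map (conjMap R F W Q α) (APlusSub R F W Q N) ≤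
      APlusSub R F W Q (latAction R F W γ N) := by
  rintro _ ⟨x, ⟨hx0, hx1⟩, rfl⟩
  rw [conjMap_apply]
  refine ⟨?_, ?_⟩
  · change _ ∈ even Q
    exact mul_mem hα.2 (mul_mem hx0 hα.1)
  · change _ ∈ Algebra.adjoin R _
    change x ∈ Algebra.adjoin R _ at hx1
    clear hx0
    induction hx1 using Algebra.adjoin_induction with
    | mem x hx =>
      obtain ⟨w, hw, rfl⟩ := hx
      rw [← mul_assoc, ← h w]
      exact Algebra.subset_adjoin ⟨γ w, ⟨w, hw, rfl⟩, rfl⟩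
    | algebraMap r =>
      rw [Algebra.commutes r, ← mul_assoc, Units.inv_mul, one_mul]
      exact Subalgebra.algebraMap_mem _ r
    | add x y _ _ hx hy =>
      rw [add_mul, mul_add]
      exact add_mem hx hy
    | mul x y _ _ hx hy =>
      have := mul_mem hx hy
      convert this using 1
      simp [mul_assoc]

theorem IsTau.map_APlusSub [CharZero F] {γ : W ≃ₗ[F] W} {α : (CliffordAlgebra Q)ˣ} (h : IsTau F W Q γ α)
    (hα : IsGPlusUnit F W Q α) (N : Submodule R W) :
    Submodule.map (conjMap R F W Q α) (APlusSub R F W Q N) =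
      APlusSub R F W Q (latAction R F W γ N) := by
  refine le_antisymm (h.map_APlusSub_le hα N) ?_
  have := Submodule.map_mono (f := conjMap R F W Q α)
    (h.inv.map_APlusSub_le (isGPlusUnit_inv hα) (latAction R F W γ N))
  rwa [map_conjMap_conjMap_inv, latAction_inv_latAction] at this

theorem IsTau.conjMap_evenFam {γ : W ≃ₗ[F] W} {α : (CliffordAlgebra Q)ˣ} (h : IsTau F W Q γ α)
    (e : Fin 3 → W) (i : Fin 4) :
    conjMap R F W Q α (evenFam Q e i) = evenFam Q (fun j => γ (e j)) i := by
  rw [conjMap_apply]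
  fin_cases i <;> simp [evenFam, h _, mul_assoc]

theorem IsTau.map_coordSpan_evenFam {γ : W ≃ₗ[F] W} {α : (CliffordAlgebra Q)ˣ}
    (h : IsTau F W Q γ α) (S : Subalgebra R F) (e : Fin 3 → W) :
    Submodule.map (conjMap R F W Q α) (coordSpan S (evenFam Q e)) =
      coordSpan S (evenFam Q fun j => γ (e j)) := by
  refine (map_coordSpan _ _).trans (congrArg _ (funext fun i => ?_))
  exact h.conjMap_evenFam (R := R) e i

theorem FamIntegral.comp {S : Subalgebra R F} {e : Fin 3 → W} (he : FamIntegral S Q e)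
    {γ : W ≃ₗ[F] W} (hγ : ∀ x, Q (γ x) = Q x) : FamIntegral S Q fun j => γ (e j) := by
  refine ⟨fun i => by rw [hγ]; exact he.1 i, fun i j => ?_⟩
  rw [QuadraticMap.polar, ← map_add, hγ, hγ, hγ]
  exact he.2 i j

theorem halfDisc_comp (e : Fin 3 → W) {γ : W ≃ₗ[F] W} (hγ : ∀ x, Q (γ x) = Q x) :
    halfDisc Q (fun j => γ (e j)) = halfDisc Q e := by
  simp only [halfDisc, QuadraticMap.polar, ← map_add, hγ]

/-- The vectors `w` with `w z - z* w ∈ J` for all `z ∈ o`; for suitable `J` this recovers a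
ternary lattice from its even Clifford order. -/
def recover (o J : Submodule R (CliffordAlgebra Q)) : Submodule R W where
  carrier := {w | ∀ z ∈ o, ι Q w * z - reverse z * ι Q w ∈ J}
  zero_mem' z _ := by simp
  add_mem' {x y} hx hy z hz := by
    rw [map_add, add_mul, mul_add, add_sub_add_comm]
    exact add_mem (hx z hz) (hy z hz)
  smul_mem' r x hx z hz := by
    rw [← algebraMap_smul F r x, map_smul, smul_mul_assoc, mul_smul_comm, ← smul_sub,
      algebraMap_smul]
    exact J.smul_mem r (hx z hz)

theorem mem_recover {o J : Submodule R (CliffordAlgebra Q)} {w : W} :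
    w ∈ recover o J ↔ ∀ z ∈ o, ι Q w * z - reverse z * ι Q w ∈ J := Iff.rfl

theorem recover_coordSpan [CharZero F] {S : Subalgebra R F} {e : Basis (Fin 3) F W}
    (he : halfDisc Q e ≠ 0) :
    recover (coordSpan S (evenFam Q e)) (coordSpan S fun _ : Fin 1 => vol Q e) =
      coordSpan S e := by
  ext w
  rw [mem_coordSpan_basis, mem_recover]
  constructor
  · intro h i
    have h1 := h (pairFam Q e i) (self_mem_coordSpan (evenFam Q e) i.succ)
    rw [ι_mul_pairFam, mem_coordSpan] at h1
    obtain ⟨c, hc, h1⟩ := h1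
    rw [Fin.sum_univ_one] at h1
    rw [smul_left_injective F (vol_ne_zero he) h1]
    exact hc 0
  · intro h z hz
    obtain ⟨c, hc, rfl⟩ := mem_coordSpan.1 hz
    have : ∀ i : Fin 4, ι Q w * evenFam Q e i - reverse (evenFam Q e i) * ι Q w ∈
        coordSpan S fun _ : Fin 1 => vol Q e := by
      intro i
      induction i using Fin.cases with
      | zero => simp [evenFam]
      | succ i =>
        change ι Q w * pairFam Q e i - reverse (pairFam Q e i) * ι Q w ∈ _
        rw [ι_mul_pairFam]
        exact smul_mem_coordSpan (h i) (self_mem_coordSpan (fun _ : Fin 1 => vol Q e) 0)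
    rw [Finset.mul_sum, map_sum, Finset.sum_mul, ← Finset.sum_sub_distrib]
    refine sum_mem fun i _ => ?_
    rw [map_smul, smul_mul_assoc, mul_smul_comm, ← smul_sub]
    exact smul_mem_coordSpan (hc i) (this i)

/-- The lattice of volumes of triples of vectors of a ternary lattice. -/
def volLat (Q : QuadraticForm F W) (N : Submodule R W) : Submodule R (CliffordAlgebra Q) :=
  Submodule.span R {z | ∃ f : Fin 3 → W, (∀ i, f i ∈ N) ∧ z = vol Q f}

end Conjugation

section Genus

variable {R F : Type*} [CommRing R] [IsDedekindDomain R] [Field F] [Algebra R F]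
  [IsFractionRing R F]
variable {W : Type*} [AddCommGroup W] [Module F W] [Module R W] [IsScalarTower R F W]
variable {Q : QuadraticForm F W}

theorem localAt_volLat {v : HeightOneSpectrum R} {N : Submodule R W} {e : Basis (Fin 3) F W}
    (hN : localAt R W v N = coordSpan (locRing R F v) e) :
    localAt R _ v (volLat Q N) = coordSpan (locRing R F v) fun _ : Fin 1 => vol Q e := by
  apply le_antisymm
  · rw [← localAt_coordSpan, localAt_le_localAt_iff, localAt_coordSpan, volLat, Submodule.span_le]
    rintro _ ⟨f, hf, rfl⟩
    rw [vol_eq_det_smul e f]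
    refine smul_mem_coordSpan ?_ (self_mem_coordSpan (fun _ : Fin 1 => vol Q e) 0)
    rw [Basis.det_apply]
    refine det_mem_of_forall_mem fun i j => ?_
    rw [Basis.toMatrix_apply]
    exact mem_coordSpan_basis.1 (hN ▸ le_localAt v N (hf j)) i
  · refine coordSpan_le (fun a ha x hx => smul_mem_localAt ha hx) fun _ => ?_
    obtain ⟨s, hs, h⟩ := exists_smul_mem_of_forall_mem_localAt (v := v) (N := N) Finset.univ
      (x := e) fun i _ => by rw [hN]; exact self_mem_coordSpan _ i
    refine mem_localAt.2 ⟨s ^ 3, pow_notMem_asIdeal hs 3, Submodule.subset_span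
      ⟨fun i => s • e i, fun i => h i (Finset.mem_univ i), ?_⟩⟩
    have := (vol Q).map_smul_univ (fun _ => algebraMap R F s) e
    simp only [algebraMap_smul] at this
    rw [this, Finset.prod_const, Finset.card_univ, Fintype.card_fin, ← map_pow, algebraMap_smul]

theorem localAt_recover (v : HeightOneSpectrum R) {o : Submodule R (CliffordAlgebra Q)}
    (ho : o.FG) (J : Submodule R (CliffordAlgebra Q)) :
    localAt R W v (recover o J) = recover (localAt R _ v o) (localAt R _ v J) := by
  ext w
  constructor
  · rintro ⟨s, hs, h⟩ z ⟨t, ht, hz⟩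
    refine mem_localAt.2 ⟨s * t, mul_notMem_asIdeal hs ht, ?_⟩
    convert h _ hz using 1
    simp only [← algebraMap_smul F s, ← algebraMap_smul F t, ← algebraMap_smul F (s * t),
      map_smul, smul_mul_assoc, mul_smul_comm, smul_sub, smul_smul, ← map_mul, mul_comm t s]
  · intro h
    let g : CliffordAlgebra Q →ₗ[R] CliffordAlgebra Q :=
      (LinearMap.mulLeft F (ι Q w) - (LinearMap.mulRight F (ι Q w)) ∘ₗ
        (reverse (Q := Q))).restrictScalars R
    obtain ⟨s, hs, h'⟩ := exists_smul_le_of_fg (ho.map g) (v := v) (N' := J) (by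
      rintro _ ⟨z, hz, rfl⟩
      exact h z (le_localAt v o hz))
    refine ⟨s, hs, fun z hz => ?_⟩
    have := h' (g z) ⟨z, hz, rfl⟩
    rw [← algebraMap_smul F s w, map_smul, smul_mul_assoc, mul_smul_comm, ← smul_sub,
      algebraMap_smul]
    exact this

end Genus

section GenusBijection

variable {F : Type*} [Field F] {W : Type*} [AddCommGroup W] [Module F W]
variable {Q : QuadraticForm F W}

variable (Q) in
/-- `γ` is an isometry of `Q` with determinant one. -/
def IsProper (γ : W ≃ₗ[F] W) : Prop :=
  (∀ x, Q (γ x) = Q x) ∧ LinearMap.det (γ : W →ₗ[F] W) = 1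

theorem IsProper.inv {γ : W ≃ₗ[F] W} (h : IsProper Q γ) : IsProper Q γ⁻¹ := by
  refine ⟨fun x => ?_, ?_⟩
  · have : γ (γ⁻¹ x) = x := γ.apply_symm_apply x
    rw [← h.1, this]
  · have h1 := LinearEquiv.det_symm_mul_det γ
    rw [h.2, mul_one] at h1
    exact h1

theorem isSOElem_iff_isProper [CharZero F] {ψ : LinearMap.BilinForm F W} (hψ : ψ.IsSymm)
    {γ : W ≃ₗ[F] W} :
    IsSOElem F W ψ γ ↔ IsProper (LinearMap.BilinMap.toQuadraticMap ψ) γ := by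
  refine and_congr_left fun _ => ⟨fun h x => h x x, fun h x y => ?_⟩
  have h1 := h (x + y)
  have h2 := h x
  have h3 := h y
  simp only [LinearMap.BilinMap.toQuadraticMap_apply, map_add, LinearMap.add_apply] at h1 h2 h3
  have h4 : ψ (γ y) (γ x) = ψ (γ x) (γ y) := hψ.eq _ _
  have h5 : ψ y x = ψ x y := hψ.eq _ _
  have : (2 : F) * ψ (γ x) (γ y) = 2 * ψ x y := by
    linear_combination h1 - h2 - h3 - h4 + h5
  exact mul_left_cancel₀ two_ne_zero this

variable {R : Type*} [CommRing R] [IsDedekindDomain R] [Algebra R F] [IsFractionRing R F]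
  [Module R W] [IsScalarTower R F W]

theorem latAction_coordSpan (S : Subalgebra R F) (γ : W ≃ₗ[F] W) {n : ℕ} (e : Fin n → W) :
    latAction R F W γ (coordSpan S e) = coordSpan S fun i => γ (e i) :=
  map_coordSpan (γ : W →ₗ[F] W) e

theorem localAt_latAction (v : HeightOneSpectrum R) (γ : W ≃ₗ[F] W) (N : Submodule R W) :
    localAt R W v (latAction R F W γ N) = latAction R F W γ (localAt R W v N) :=
  localAt_map (F := F) v _ N

theorem localAt_map_conjMap (v : HeightOneSpectrum R) (α : (CliffordAlgebra Q)ˣ)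
    (o : Submodule R (CliffordAlgebra Q)) :
    localAt R _ v (Submodule.map (conjMap R F W Q α) o) =
      Submodule.map (conjMap R F W Q α) (localAt R _ v o) :=
  localAt_map (F := F) v _ o

variable [CharZero F]

theorem vol_comp_isProper {γ : W ≃ₗ[F] W} (hγ : IsProper Q γ) (e : Basis (Fin 3) F W) :
    (vol Q fun i => γ (e i)) = vol Q e := by
  have := vol_comp (Q := Q) e (γ : W →ₗ[F] W)
  rw [hγ.2, one_smul] at this
  exact this

theorem localAt_APlusSub_of_isProper {v : HeightOneSpectrum R} {M N : Submodule R W}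
    {e : Basis (Fin 3) F W} (he : FamIntegral (locRing R F v) Q e)
    (hM : localAt R W v M = coordSpan (locRing R F v) e) {γ : W ≃ₗ[F] W} (hγ : IsProper Q γ)
    (hN : localAt R W v N = latAction R F W γ (localAt R W v M)) :
    localAt R _ v (APlusSub R F W Q N) =
      coordSpan (locRing R F v) (evenFam Q fun i => γ (e i)) :=
  localAt_APlusSub (he.comp hγ.1) (by rw [hN, hM, latAction_coordSpan])

theorem localAt_eq_recover {v : HeightOneSpectrum R} {M N : Submodule R W}
    {e : Basis (Fin 3) F W} (hd : halfDisc Q e ≠ 0) (he : FamIntegral (locRing R F v) Q e)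
    (hM : localAt R W v M = coordSpan (locRing R F v) e) {γ : W ≃ₗ[F] W} (hγ : IsProper Q γ)
    (hN : localAt R W v N = latAction R F W γ (localAt R W v M)) :
    localAt R W v N = recover (localAt R _ v (APlusSub R F W Q N))
      (coordSpan (locRing R F v) fun _ : Fin 1 => vol Q e) := by
  have h := recover_coordSpan (S := locRing R F v) (e := e.map γ) (Q := Q)
  have h' : ⇑(e.map γ) = fun i => γ (e i) := funext fun i => Basis.map_apply _ _ _
  rw [h', vol_comp_isProper hγ, halfDisc_comp _ hγ.1] at h
  rw [localAt_APlusSub_of_isProper he hM hγ hN, h hd, hN, hM, latAction_coordSpan]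

theorem exists_heightOneSpectrum (hR : ¬ IsField R) : Nonempty (HeightOneSpectrum R) := by
  obtain ⟨I, hI⟩ := Ideal.exists_maximal R
  exact ⟨⟨I, hI.isPrime, Ring.ne_bot_of_isMaximal_of_not_isField hI hR⟩⟩

variable [Module.Finite F W]

/-- A lattice whose localizations are conjugate to those of `A⁺(M)` is finitely generated. -/
theorem fg_of_orderInGenus (hR : ¬ IsField R) (hW : finrank F W = 3) {M : Submodule R W}
    (hM : IsLat R F W M) (hQ : QuadIntegral Q M) (hd : ∀ e : Basis (Fin 3) F W, halfDisc Q e ≠ 0)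
    {o : Submodule R (CliffordAlgebra Q)} (ho : OrderInGenus R F W Q (APlusSub R F W Q M) o) :
    o.FG := by
  have key : ∀ v : HeightOneSpectrum R, ∃ f : Basis (Fin 3) F W,
      FamIntegral (locRing R F v) Q f ∧
        localAt R _ v o = coordSpan (locRing R F v) (evenFam Q f) := by
    intro v
    obtain ⟨α, hα, h⟩ := ho v
    obtain ⟨e, he⟩ := exists_basis_localAt v hW hM
    have hi : FamIntegral (locRing R F v) Q e :=
      hQ.famIntegral fun i => he ▸ self_mem_coordSpan _ i
    obtain ⟨γ, hγ, hγQ, hγd⟩ := exists_isTau (hd e) hα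
    have h' : ⇑(e.map γ) = fun i => γ (e i) := funext fun i => Basis.map_apply _ _ _
    refine ⟨e.map γ, by rw [h']; exact hi.comp hγQ, ?_⟩
    rw [← h, localAt_APlusSub hi he, hγ.map_coordSpan_evenFam, h']
  obtain ⟨v₀⟩ := exists_heightOneSpectrum hR
  obtain ⟨f, -, hfo⟩ := key v₀
  have hfg : (evenComap Q o).FG := by
    refine fg_evenComap hR (hd f) (fun v x hx y hy => ?_) fun i => ?_
    · obtain ⟨g, hgi, hgo⟩ := key v
      exact normTrace_mem_of_coordSpan hgi (hgo ▸ le_localAt v o hx) (hgo ▸ le_localAt v o hy)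
    · have : evenFam Q f i ∈ localAt R _ v₀ o := hfo ▸ self_mem_coordSpan _ i
      obtain ⟨s, hs, h⟩ := mem_localAt.1 this
      exact ⟨s, ne_zero_of_notMem_asIdeal hs, h⟩
  rw [← map_evenComap (Q := Q) (o := o) fun x hx =>
    coordSpan_evenFam_le_evenR _ _ (hfo ▸ le_localAt v₀ o hx)]
  exact hfg.map _

theorem orderInGenus_APlusSub {ψ : LinearMap.BilinForm F W} (hψ : ψ.IsSymm)
    {M N : Submodule R W} (e : Basis (Fin 3) F W)
    (hd : halfDisc (LinearMap.BilinMap.toQuadraticMap ψ) e ≠ 0) (hN : InGenus R F W ψ M N) :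
    OrderInGenus R F W (LinearMap.BilinMap.toQuadraticMap ψ)
      (APlusSub R F W (LinearMap.BilinMap.toQuadraticMap ψ) M)
      (APlusSub R F W (LinearMap.BilinMap.toQuadraticMap ψ) N) := by
  intro v
  obtain ⟨γ, hγ, h⟩ := hN v
  have hγ' := ((isSOElem_iff_isProper hψ).1 hγ).inv
  obtain ⟨α, hα, hτ⟩ := exists_unit_isTau hd hγ'.1 hγ'.2
  refine ⟨α, hα, ?_⟩
  rw [← localAt_map_conjMap, hτ.map_APlusSub hα, ← localAt_APlusSub_localAt, localAt_latAction,
    ← h, latAction_inv_latAction, localAt_APlusSub_localAt]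

theorem InGenus.exists_eq_latAction {ψ : LinearMap.BilinForm F W} (hψ : ψ.IsSymm)
    {M N : Submodule R W} (hN : InGenus R F W ψ M N) (v : HeightOneSpectrum R) :
    ∃ γ : W ≃ₗ[F] W, IsProper (LinearMap.BilinMap.toQuadraticMap ψ) γ ∧
      localAt R W v N = latAction R F W γ (localAt R W v M) := by
  obtain ⟨γ, hγ, h⟩ := hN v
  exact ⟨γ⁻¹, ((isSOElem_iff_isProper hψ).1 hγ).inv, by rw [← h, latAction_inv_latAction]⟩

theorem APlusSub_injOn_genus (hR : ¬ IsField R) (hW : finrank F W = 3)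
    {ψ : LinearMap.BilinForm F W} (hψ : ψ.IsSymm) {M : Submodule R W}
    (hM : IsLat R F W M) (hQ : QuadIntegral (LinearMap.BilinMap.toQuadraticMap ψ) M)
    (hd : ∀ e : Basis (Fin 3) F W, halfDisc (LinearMap.BilinMap.toQuadraticMap ψ) e ≠ 0)
    {N N' : Submodule R W} (hN : InGenus R F W ψ M N) (hN' : InGenus R F W ψ M N')
    (h : APlusSub R F W (LinearMap.BilinMap.toQuadraticMap ψ) N =
      APlusSub R F W (LinearMap.BilinMap.toQuadraticMap ψ) N') : N = N' := by
  refine eq_of_forall_localAt_eq hR fun v => ?_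
  obtain ⟨e, he⟩ := exists_basis_localAt v hW hM
  have hi : FamIntegral (locRing R F v) (LinearMap.BilinMap.toQuadraticMap ψ) e :=
    hQ.famIntegral fun i => he ▸ self_mem_coordSpan _ i
  obtain ⟨γ, hγ, hγN⟩ := hN.exists_eq_latAction hψ v
  obtain ⟨γ', hγ', hγN'⟩ := hN'.exists_eq_latAction hψ v
  rw [localAt_eq_recover (hd e) hi he hγ hγN, localAt_eq_recover (hd e) hi he hγ' hγN', h]

theorem exists_APlusSub_eq (hR : ¬ IsField R) (hW : finrank F W = 3)
    {ψ : LinearMap.BilinForm F W} (hψ : ψ.IsSymm) {M : Submodule R W}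
    (hM : IsLat R F W M) (hQ : QuadIntegral (LinearMap.BilinMap.toQuadraticMap ψ) M)
    (hd : ∀ e : Basis (Fin 3) F W, halfDisc (LinearMap.BilinMap.toQuadraticMap ψ) e ≠ 0)
    {o : Submodule R (CliffordAlgebra (LinearMap.BilinMap.toQuadraticMap ψ))}
    (ho : OrderInGenus R F W (LinearMap.BilinMap.toQuadraticMap ψ)
      (APlusSub R F W (LinearMap.BilinMap.toQuadraticMap ψ) M) o) :
    ∃ N, InGenus R F W ψ M N ∧ APlusSub R F W (LinearMap.BilinMap.toQuadraticMap ψ) N = o := by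
  have hfg := fg_of_orderInGenus hR hW hM hQ hd ho
  have key : ∀ v : HeightOneSpectrum R, ∃ γ : W ≃ₗ[F] W,
      IsProper (LinearMap.BilinMap.toQuadraticMap ψ) γ ∧
      localAt R W v (recover o (volLat (LinearMap.BilinMap.toQuadraticMap ψ) M)) =
        latAction R F W γ (localAt R W v M) ∧
      localAt R _ v (APlusSub R F W (LinearMap.BilinMap.toQuadraticMap ψ)
        (recover o (volLat (LinearMap.BilinMap.toQuadraticMap ψ) M))) = localAt R _ v o := by
    intro v
    obtain ⟨α, hα, h⟩ := ho v
    obtain ⟨e, he⟩ := exists_basis_localAt v hW hM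
    have hi : FamIntegral (locRing R F v) (LinearMap.BilinMap.toQuadraticMap ψ) e :=
      hQ.famIntegral fun i => he ▸ self_mem_coordSpan _ i
    obtain ⟨γ, hγ, hγQ⟩ := exists_isTau (hd e) hα
    rw [localAt_APlusSub hi he, hγ.map_coordSpan_evenFam] at h
    have hrec := recover_coordSpan (S := locRing R F v) (e := e.map γ)
      (Q := LinearMap.BilinMap.toQuadraticMap ψ)
    have h' : ⇑(e.map γ) = fun i => γ (e i) := funext fun i => Basis.map_apply _ _ _
    rw [h', vol_comp_isProper hγQ, halfDisc_comp _ hγQ.1] at hrec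
    have hN : localAt R W v (recover o (volLat (LinearMap.BilinMap.toQuadraticMap ψ) M)) =
        latAction R F W γ (localAt R W v M) := by
      rw [localAt_recover v hfg, localAt_volLat he, ← h, hrec (hd e), he, latAction_coordSpan]
    exact ⟨γ, hγQ, hN, by rw [localAt_APlusSub_of_isProper hi he hγQ hN, h]⟩
  refine ⟨_, fun v => ?_, eq_of_forall_localAt_eq hR fun v => (key v).choose_spec.2.2⟩
  obtain ⟨γ, hγ, hN, -⟩ := key v
  exact ⟨γ⁻¹, (isSOElem_iff_isProper hψ).2 hγ.inv, by rw [hN, latAction_inv_latAction]⟩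

theorem InGenus.latAction {ψ : LinearMap.BilinForm F W} (hψ : ψ.IsSymm) {M N : Submodule R W}
    (hN : InGenus R F W ψ M N) {γ : W ≃ₗ[F] W} (hγ : IsSOElem F W ψ γ) :
    InGenus R F W ψ M (latAction R F W γ N) := by
  intro v
  obtain ⟨δ, hδ, h⟩ := hN v
  have hγ' := (isSOElem_iff_isProper hψ).2 ((isSOElem_iff_isProper hψ).1 hγ).inv
  refine ⟨δ * γ⁻¹, ⟨fun x y => ?_, ?_⟩, ?_⟩
  · rw [LinearEquiv.mul_apply, LinearEquiv.mul_apply, hδ.1, hγ'.1]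
  · have : ((δ * γ⁻¹ : W ≃ₗ[F] W) : W →ₗ[F] W) =
      (δ : W →ₗ[F] W) ∘ₗ ((γ⁻¹ : W ≃ₗ[F] W) : W →ₗ[F] W) := rfl
    rw [this, LinearMap.det_comp, hδ.2, hγ'.2, one_mul]
  · rw [localAt_latAction, latAction_mul, latAction_inv_latAction, h]

theorem card_genus_eq_card_orderGenus (hR : ¬ IsField R) (hW : finrank F W = 3)
    {ψ : LinearMap.BilinForm F W} (hψ : ψ.IsSymm) {M : Submodule R W}
    (hM : IsLat R F W M) (hQ : QuadIntegral (LinearMap.BilinMap.toQuadraticMap ψ) M)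
    (hd : ∀ e : Basis (Fin 3) F W, halfDisc (LinearMap.BilinMap.toQuadraticMap ψ) e ≠ 0) :
    Nat.card (Quot (fun (N N' : {N : Submodule R W // InGenus R F W ψ M N}) =>
        ∃ γ : W ≃ₗ[F] W, IsSOElem F W ψ γ ∧ latAction R F W γ N.1 = N'.1)) =
      Nat.card (Quot (fun (o o' : {o : Submodule R
          (CliffordAlgebra (LinearMap.BilinMap.toQuadraticMap ψ)) //
          OrderInGenus R F W (LinearMap.BilinMap.toQuadraticMap ψ)
            (APlusSub R F W (LinearMap.BilinMap.toQuadraticMap ψ) M) o}) =>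
        ∃ α : (CliffordAlgebra (LinearMap.BilinMap.toQuadraticMap ψ))ˣ,
          IsGPlusUnit F W (LinearMap.BilinMap.toQuadraticMap ψ) α ∧
          Submodule.map (conjMap R F W (LinearMap.BilinMap.toQuadraticMap ψ) α) o.1 = o'.1)) := by
  let e : Basis (Fin 3) F W := (finBasis F W).reindex (finCongr hW)
  refine Nat.card_congr (Quot.congr (Equiv.ofBijective
    (fun N => ⟨_, orderInGenus_APlusSub hψ e (hd e) N.2⟩) ⟨fun N N' h => ?_, fun o => ?_⟩)
    fun N N' => ⟨?_, ?_⟩)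
  · exact Subtype.ext (APlusSub_injOn_genus hR hW hψ hM hQ hd N.2 N'.2 (congrArg Subtype.val h))
  · obtain ⟨N, hN, h⟩ := exists_APlusSub_eq hR hW hψ hM hQ hd o.2
    exact ⟨⟨N, hN⟩, Subtype.ext h⟩
  · rintro ⟨γ, hγ, h⟩
    have hγ' := (isSOElem_iff_isProper hψ).1 hγ
    obtain ⟨α, hα, hτ⟩ := exists_unit_isTau (hd e) hγ'.1 hγ'.2
    refine ⟨α, hα, ?_⟩
    change Submodule.map _ (APlusSub _ _ _ _ N.1) = APlusSub _ _ _ _ N'.1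
    rw [hτ.map_APlusSub hα, h]
  · rintro ⟨α, hα, h⟩
    obtain ⟨γ, hτ, hγ⟩ := exists_isTau (hd e) hα
    have hγ' := (isSOElem_iff_isProper hψ).2 hγ
    refine ⟨γ, hγ', APlusSub_injOn_genus hR hW hψ hM hQ hd (N.2.latAction hψ hγ') N'.2 ?_⟩
    rw [← hτ.map_APlusSub hα]
    exact h

end GenusBijection

section OrthogonalComplement

variable {F : Type*} [Field F] [CharZero F] {V : Type*} [AddCommGroup V] [Module F V]
variable {φ : LinearMap.BilinForm F V} {h : V}

/-- The quadratic form on the orthogonal complement of `h`. -/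
abbrev perpQuad (φ : LinearMap.BilinForm F V) (U : Submodule F V) : QuadraticForm F U :=
  LinearMap.BilinMap.toQuadraticMap (LinearMap.BilinForm.restrict φ U)

theorem mem_ker_flip {x : V} : x ∈ LinearMap.ker (φ.flip h) ↔ φ x h = 0 := Iff.rfl

/-- Completing a basis of `h^⊥` by a vector not orthogonal to `h`. -/
noncomputable def consBasis (hφ : φ.IsSymm) {y : V} (hy : φ h y ≠ 0) {n : ℕ}
    (e : Basis (Fin n) F (LinearMap.ker (φ.flip h))) : Basis (Fin (n + 1)) F V :=
  Basis.mkFinCons y e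
    (fun c x hx hc => by
      have h1 : φ (c • y + x) h = 0 := by rw [hc, map_zero, LinearMap.zero_apply]
      rw [map_add, LinearMap.add_apply, mem_ker_flip.1 hx, map_smul, LinearMap.smul_apply,
        smul_eq_mul, add_zero, hφ.eq y h] at h1
      exact (mul_eq_zero.1 h1).resolve_right hy)
    (fun z => ⟨-(φ h z / φ h y), by
      have h1 : φ z h = φ h z := hφ.eq _ _
      have h2 : φ y h = φ h y := hφ.eq _ _
      rw [mem_ker_flip, map_add, LinearMap.add_apply, map_smul, LinearMap.smul_apply, h1, h2,
        smul_eq_mul]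
      field_simp
      ring⟩)

theorem coe_consBasis (hφ : φ.IsSymm) {y : V} (hy : φ h y ≠ 0) {n : ℕ}
    (e : Basis (Fin n) F (LinearMap.ker (φ.flip h))) :
    ⇑(consBasis hφ hy e) = Fin.cons y fun i => (e i : V) :=
  Basis.coe_mkFinCons _ _ _ _

theorem mul_det_gram2_consBasis (hφ : φ.IsSymm) (hq : φ h h ≠ 0) {y : V} (hy : φ h y ≠ 0)
    (e : Basis (Fin 3) F (LinearMap.ker (φ.flip h))) :
    φ h h * (gram2 φ (consBasis hφ hy e)).det =
      4 * φ h y ^ 2 * halfDisc (perpQuad φ (LinearMap.ker (φ.flip h))) e := by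
  have hsw : ∀ a b : V, φ a b = φ b a := fun a b => hφ.eq a b
  obtain ⟨t, w, hw, rfl⟩ : ∃ (t : F) (w : V), w ∈ LinearMap.ker (φ.flip h) ∧ y = t • h + w := by
    refine ⟨φ h y / φ h h, y - (φ h y / φ h h) • h, ?_, by abel⟩
    rw [mem_ker_flip, map_sub, LinearMap.sub_apply, map_smul, LinearMap.smul_apply, smul_eq_mul,
      div_mul_cancel₀ _ hq, hsw y h, sub_self]
  obtain ⟨c, hc⟩ : ∃ c : Fin 3 → F, w = c 0 • (e 0 : V) + c 1 • (e 1 : V) + c 2 • (e 2 : V) := by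
    refine ⟨fun i => e.repr ⟨w, hw⟩ i, ?_⟩
    have := congrArg Subtype.val (e.sum_repr ⟨w, hw⟩)
    rw [Fin.sum_univ_three] at this
    exact this.symm
  have he : ∀ i, φ h (e i) = 0 := fun i => (hsw _ _).trans (e i).2
  have he' : ∀ i, φ (e i) h = 0 := fun i => (e i).2
  subst hc
  simp only [halfDisc, LinearMap.BilinMap.toQuadraticMap_apply,
    LinearMap.BilinMap.polar_toQuadraticMap, LinearMap.BilinForm.restrict_apply]
  have e10 := hsw (e 1) (e 0)
  have e20 := hsw (e 2) (e 0)
  have e21 := hsw (e 2) (e 1)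
  obtain ⟨p, hp⟩ : ∃ p, p = φ (e 0) (e 0) := ⟨_, rfl⟩
  obtain ⟨r, hr⟩ : ∃ r, r = φ (e 1) (e 1) := ⟨_, rfl⟩
  obtain ⟨s, hs⟩ : ∃ s, s = φ (e 2) (e 2) := ⟨_, rfl⟩
  obtain ⟨k, hk⟩ : ∃ k, k = φ (e 0) (e 1) := ⟨_, rfl⟩
  obtain ⟨l, hl⟩ : ∃ l, l = φ (e 0) (e 2) := ⟨_, rfl⟩
  obtain ⟨m, hm⟩ : ∃ m, m = φ (e 1) (e 2) := ⟨_, rfl⟩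
  rw [← hk] at e10
  rw [← hl] at e20
  rw [← hm] at e21
  have hv : ∀ y (hy : φ h y ≠ 0), ⇑(consBasis hφ hy e) = ![y, (e 0 : V), (e 1 : V), (e 2 : V)] :=
    fun y hy => by
      rw [coe_consBasis]
      ext i
      fin_cases i <;> rfl
  have hG : gram2 φ (consBasis hφ hy e) =
      !![2 * (t ^ 2 * φ h h + (c 0 * (c 0 * p + c 1 * k + c 2 * l) +
            c 1 * (c 0 * k + c 1 * r + c 2 * m) + c 2 * (c 0 * l + c 1 * m + c 2 * s))),
          2 * (c 0 * p + c 1 * k + c 2 * l), 2 * (c 0 * k + c 1 * r + c 2 * m),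
          2 * (c 0 * l + c 1 * m + c 2 * s);
        2 * (c 0 * p + c 1 * k + c 2 * l), 2 * p, 2 * k, 2 * l;
        2 * (c 0 * k + c 1 * r + c 2 * m), 2 * k, 2 * r, 2 * m;
        2 * (c 0 * l + c 1 * m + c 2 * s), 2 * l, 2 * m, 2 * s] := by
    ext i j
    fin_cases i <;> fin_cases j <;>
      simp [gram2, hv, he, he', e10, e20, e21, ← hp, ← hr, ← hs, ← hk, ← hl, ← hm] <;>
      ring
  have hb : φ h (t • h + (c 0 • (e 0 : V) + c 1 • (e 1 : V) + c 2 • (e 2 : V))) = t * φ h h := by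
    simp [he]
  rw [hG, hb]
  simp only [LinearMap.domRestrict_apply, ← hp, ← hr, ← hs, ← hk, ← hl,
    ← hm, e10, e20, e21]
  simp [Matrix.det_succ_row_zero, Fin.sum_univ_succ, Fin.succAbove]
  ring

end OrthogonalComplement

section Nondegeneracy

variable {F : Type*} [Field F] [CharZero F] {V : Type*} [AddCommGroup V] [Module F V]
variable {φ : LinearMap.BilinForm F V} {h : V}

theorem finrank_ker_flip [Module.Finite F V] {n : ℕ} (hV : finrank F V = n + 1)
    (hq : φ h h ≠ 0) : finrank F (LinearMap.ker (φ.flip h)) = n := by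
  have h0 : φ.flip h ≠ 0 := fun h0 => hq (by
    have := LinearMap.congr_fun h0 h
    exact this)
  have := Module.Dual.finrank_ker_add_one_of_ne_zero h0
  omega

theorem det_gram2_ne_zero (hnd : φ.Nondegenerate) {n : ℕ} (b : Basis (Fin n) F V) :
    (gram2 φ b).det ≠ 0 := by
  have : gram2 φ b = (2 : F) • LinearMap.BilinForm.toMatrix b φ := by
    ext i j
    simp [gram2, LinearMap.BilinForm.toMatrix_apply]
  rw [this, Matrix.det_smul]
  exact mul_ne_zero (pow_ne_zero _ two_ne_zero)
    ((LinearMap.BilinForm.nondegenerate_iff_det_ne_zero b).1 hnd)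

theorem halfDisc_perpQuad_ne_zero (hφ : φ.IsSymm) (hnd : φ.Nondegenerate) (hq : φ h h ≠ 0)
    (e : Basis (Fin 3) F (LinearMap.ker (φ.flip h))) :
    halfDisc (perpQuad φ (LinearMap.ker (φ.flip h))) e ≠ 0 := by
  have h1 := mul_det_gram2_consBasis hφ hq hq e
  intro h0
  rw [h0, mul_zero] at h1
  exact mul_ne_zero hq (det_gram2_ne_zero hnd _) h1

end Nondegeneracy

section LatticeSection

variable {R F : Type*} [CommRing R] [IsDedekindDomain R] [Field F] [Algebra R F]
  [IsFractionRing R F]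
variable {V : Type*} [AddCommGroup V] [Module F V] [Module R V] [IsScalarTower R F V]

theorem FamIntegral.halfDisc_mem {W : Type*} [AddCommGroup W] [Module F W]
    {Q : QuadraticForm F W} {S : Subalgebra R F} {e : Fin 3 → W} (he : FamIntegral S Q e) :
    halfDisc Q e ∈ S := by
  obtain ⟨h1, h2⟩ := he
  have h4 : (4 : F) ∈ S := by exact_mod_cast natCast_mem S 4
  unfold halfDisc
  refine sub_mem (sub_mem (sub_mem (add_mem (mul_mem (mul_mem (mul_mem h4 ?_) ?_) ?_)
    (mul_mem (mul_mem ?_ ?_) ?_)) (mul_mem ?_ (pow_mem ?_ _))) (mul_mem ?_ (pow_mem ?_ _)))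
    (mul_mem ?_ (pow_mem ?_ _))
  all_goals first | exact h1 _ | exact h2 _ _

/-- The intersection of a lattice with a subspace. -/
abbrev latInter (U : Submodule F V) (L : Submodule R V) : Submodule R U :=
  Submodule.comap (U.subtype.restrictScalars R) L

theorem localAt_latInter (v : HeightOneSpectrum R) (U : Submodule F V) (L : Submodule R V) :
    localAt R U v (latInter U L) = latInter U (localAt R V v L) := rfl

theorem isLat_latInter {L : Submodule R V} (hL : IsLat R F V L) (U : Submodule F V) :
    IsLat R F U (latInter U L) := by
  constructor
  · refine Submodule.fg_of_fg_map_injective (U.subtype.restrictScalars R) Subtype.val_injective ?_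
    have : IsNoetherian R L := isNoetherian_of_fg_of_noetherian L hL.1
    exact Submodule.FG.of_le hL.1 (Submodule.map_comap_le _ _)
  · refine eq_top_iff.2 fun w _ => ?_
    have hw : (w : V) ∈ Submodule.span F (L : Set V) := hL.2 ▸ Submodule.mem_top
    obtain ⟨s, hs, h⟩ := exists_smul_mem_of_mem_span hw
    have hs' : algebraMap R F s ≠ 0 := fun h0 =>
      hs ((map_eq_zero_iff _ (IsFractionRing.injective R F)).1 h0)
    have : w = (algebraMap R F s)⁻¹ • s • w := by
      rw [← algebraMap_smul F s w, smul_smul, inv_mul_cancel₀ hs', one_smul]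
    rw [this]
    exact Submodule.smul_mem _ _ (Submodule.subset_span h)

theorem LocGen.localAt_eq {v : HeightOneSpectrum R} {I J : Submodule R F} {d : F}
    (hI : LocGen v I d) (hJ : LocGen v J d) : localAt R F v I = localAt R F v J :=
  Eq.trans hI hJ.symm

theorem LocGen.localAt_le {v : HeightOneSpectrum R} {I J : Submodule R F} {c d : F}
    (hc : c ∈ locRing R F v) (hI : LocGen v I (d * c)) (hJ : LocGen v J d) :
    localAt R F v I ≤ localAt R F v J := by
  rw [hI, hJ]
  refine coordSpan_le (fun a ha x hx => smul_mem_coordSpan ha hx) fun _ => ?_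
  exact mem_coordSpan_const.2 ⟨c, hc, mul_comm _ _⟩

variable [CharZero F] {φ : LinearMap.BilinForm F V} {h : V}

/-- The fractional ideal `2φ(h, L)`. -/
abbrev twoForm (φ : LinearMap.BilinForm F V) (h : V) (L : Submodule R V) : Submodule R F :=
  Submodule.map (((2 : F) • (φ h)).restrictScalars R) L

theorem isLat_twoForm (hq : φ h h ≠ 0) {L : Submodule R V} (hL : IsLat R F V L) :
    IsLat R F F (twoForm φ h L) := by
  refine ⟨hL.1.map _, ?_⟩
  have h1 : Submodule.span F (twoForm φ h L : Set F) =
      Submodule.map ((2 : F) • φ h) (Submodule.span F (L : Set V)) := by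
    rw [Submodule.map_span]
    rfl
  rw [h1, hL.2]
  refine eq_top_iff.2 fun x _ => ⟨(x / (2 * φ h h)) • h, trivial, ?_⟩
  simp only [map_smul, LinearMap.smul_apply, smul_eq_mul]
  field_simp

theorem exists_locGen_twoForm (v : HeightOneSpectrum R) (hq : φ h h ≠ 0) {L : Submodule R V}
    (hL : IsLat R F V L) : ∃ y ∈ localAt R V v L, φ h y ≠ 0 ∧
      LocGen v (twoForm φ h L) (2 * φ h y) := by
  obtain ⟨b, hb⟩ := exists_basis_localAt v (finrank_self F) (isLat_twoForm hq hL)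
  have h0 : b 0 ∈ localAt R F v (twoForm φ h L) := hb ▸ self_mem_coordSpan _ 0
  rw [twoForm, localAt_map (F := F)] at h0
  obtain ⟨y, hy, h1⟩ := h0
  have h1 : 2 * φ h y = b 0 := h1
  have h2 : (fun _ : Fin 1 => 2 * φ h y) = b := funext fun i => by
    rw [h1, Subsingleton.elim i 0]
  refine ⟨y, hy, fun h3 => b.ne_zero 0 ?_, hb.trans (by rw [h2])⟩
  rw [← h1, h3, mul_zero]

theorem localAt_eq_coordSpan_consBasis (hφ : φ.IsSymm) {v : HeightOneSpectrum R}
    {L : Submodule R V} {y : V} (hyL : y ∈ localAt R V v L) (hy : φ h y ≠ 0)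
    (hgen : LocGen v (twoForm φ h L) (2 * φ h y))
    {e : Basis (Fin 3) F (LinearMap.ker (φ.flip h))}
    (he : localAt R _ v (latInter (LinearMap.ker (φ.flip h)) L) =
      coordSpan (locRing R F v) e) :
    localAt R V v L = coordSpan (locRing R F v) (consBasis hφ hy e) := by
  rw [coe_consBasis]
  rw [localAt_latInter] at he
  apply le_antisymm
  · intro x hx
    have hx' : 2 * φ h x ∈ localAt R F v (twoForm φ h L) := by
      rw [twoForm, localAt_map (F := F)]
      exact ⟨x, hx, rfl⟩
    rw [hgen, mem_coordSpan_const] at hx'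
    obtain ⟨c, hc, hcx⟩ := hx'
    have hcx : φ h x = c * φ h y := by
      refine mul_left_cancel₀ (two_ne_zero (α := F)) ?_
      rw [hcx]
      ring
    have hm : x - c • y ∈ LinearMap.ker (φ.flip h) := by
      have h1 : φ x h = φ h x := hφ.eq _ _
      have h2 : φ y h = φ h y := hφ.eq _ _
      rw [mem_ker_flip, map_sub, LinearMap.sub_apply, map_smul, LinearMap.smul_apply, h1, h2, hcx,
        smul_eq_mul, sub_self]
    have hm' : (⟨x - c • y, hm⟩ : LinearMap.ker (φ.flip h)) ∈
        latInter (LinearMap.ker (φ.flip h)) (localAt R V v L) :=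
      sub_mem hx (smul_mem_localAt hc hyL)
    rw [he] at hm'
    obtain ⟨d, hd, h3⟩ := mem_coordSpan.1 hm'
    have h4 := congrArg Subtype.val h3
    rw [Fin.sum_univ_three] at h4
    refine mem_coordSpan.2 ⟨Fin.cons c d, fun i => ?_, ?_⟩
    · induction i using Fin.cases with
      | zero => exact hc
      | succ i => exact hd i
    · rw [Fin.sum_univ_succ, Fin.sum_univ_three]
      simp only [Fin.cons_zero, Fin.cons_succ]
      exact (sub_eq_iff_eq_add'.1 h4)
  · refine coordSpan_le (fun a ha x hx => smul_mem_localAt ha hx) fun i => ?_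
    induction i using Fin.cases with
    | zero => exact hyL
    | succ i =>
      have : e i ∈ latInter (LinearMap.ker (φ.flip h)) (localAt R V v L) := by
        rw [he]
        exact self_mem_coordSpan _ i
      exact this

/-- Local generators of the three ideals entering the discriminant formula. -/
theorem exists_locGen_discriminant (hR : ¬ IsField R) [Module.Finite F V] (hV : finrank F V = 4)
    (hφ : φ.IsSymm) (hnd : φ.Nondegenerate) (hq : φ h h ≠ 0) {L : Submodule R V}
    (hL : IsIntegralLat R F V φ L) (v : HeightOneSpectrum R) :
    ∃ b : F, ∃ D ∈ locRing R F v, LocGen v (twoForm φ h L) b ∧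
      LocGen v (Submodule.span R {φ h h} * latIdx R F V (dualLat R F V φ L) L) (b * b * D) ∧
      LocGen v (APlusDualIdx R F _ (LinearMap.BilinForm.restrict φ (LinearMap.ker (φ.flip h)))
        (latInter (LinearMap.ker (φ.flip h)) L)) (D ^ 2) := by
  have hM := isLat_latInter hL.1 (LinearMap.ker (φ.flip h))
  have hQ : QuadIntegral (perpQuad φ (LinearMap.ker (φ.flip h)))
      (latInter (LinearMap.ker (φ.flip h)) L) := fun x hx => hL.2 x hx
  obtain ⟨e, he⟩ := exists_basis_localAt v (finrank_ker_flip hV hq) hM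
  obtain ⟨y, hyL, hy, hgen⟩ := exists_locGen_twoForm v hq hL.1
  refine ⟨_, halfDisc (perpQuad φ (LinearMap.ker (φ.flip h))) e, ?_, hgen, ?_, ?_⟩
  · exact (hQ.famIntegral (v := v) fun i => he ▸ self_mem_coordSpan _ i).halfDisc_mem
  · have h1 := (locGen_span_singleton v (φ h h)).mul
      (locGen_latIdx_dualLat (det_gram2_ne_zero hnd _) hL.1.1
        (localAt_eq_coordSpan_consBasis hφ hyL hy hgen he))
    rw [mul_det_gram2_consBasis hφ hq hy] at h1
    convert h1 using 1
    ring
  · exact locGen_latIdx_normDual hR hM hQ (halfDisc_perpQuad_ne_zero hφ hnd hq e) he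

end LatticeSection

end Paper

open Paper NumberField IsDedekindDomain

section

variable (F : Type*) [Field F] [NumberField F]
variable (R : Type*) [CommRing R] [IsDedekindDomain R] [Algebra R F] [IsFractionRing R F]
  [IsIntegralClosure R ℤ F]
variable (V : Type*) [AddCommGroup V] [Module F V] [Module R V] [IsScalarTower R F V]

set_option synthInstance.maxHeartbeats 1000000 in
set_option maxHeartbeats 1000000 in
/-- The class number of the `SO^ψ`-genus of `L∩W` equals the type
number of the order `𝔬 = A⁺(L∩W)`, whose discriminant is `q[L̃/L](2φ(h,L))⁻²`
(the discriminant clause being expressed without ideal inverses). -/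
theorem statement9
    (hV : Module.finrank F V = 4)
    (φ : LinearMap.BilinForm F V) (hsymm : φ.IsSymm)
    (hnd : LinearMap.BilinForm.Nondegenerate φ)
    (h : V) (hq : φ h h ≠ 0)
    (Wsub : Submodule F V) (hWsub : Wsub = LinearMap.ker (φ.flip h))
    (L : Submodule R V) (hL : IsMaximalLat R F V φ L) :
    Nat.card (Quot (fun (N N' : {N : Submodule R ↥Wsub //
          InGenus R F ↥Wsub (LinearMap.BilinForm.restrict φ Wsub) (Submodule.comap ((Wsub.subtype).restrictScalars R) L) N}) =>
        ∃ γ : ↥Wsub ≃ₗ[F] ↥Wsub, IsSOElem F ↥Wsub (LinearMap.BilinForm.restrict φ Wsub) γ ∧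
          latAction R F ↥Wsub γ N.1 = N'.1)) =
      Nat.card (Quot (fun (o o' : {o : Submodule R (CliffordAlgebra (LinearMap.BilinMap.toQuadraticMap (LinearMap.BilinForm.restrict φ Wsub))) //
          OrderInGenus R F ↥Wsub (LinearMap.BilinMap.toQuadraticMap (LinearMap.BilinForm.restrict φ Wsub)) (APlusSub R F ↥Wsub (LinearMap.BilinMap.toQuadraticMap (LinearMap.BilinForm.restrict φ Wsub)) (Submodule.comap ((Wsub.subtype).restrictScalars R) L)) o}) =>
        ∃ α : (CliffordAlgebra (LinearMap.BilinMap.toQuadraticMap (LinearMap.BilinForm.restrict φ Wsub)))ˣ, IsGPlusUnit F ↥Wsub (LinearMap.BilinMap.toQuadraticMap (LinearMap.BilinForm.restrict φ Wsub)) α ∧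
          Submodule.map (conjMap R F ↥Wsub (LinearMap.BilinMap.toQuadraticMap (LinearMap.BilinForm.restrict φ Wsub)) α) o.1 = o'.1)) ∧
    Submodule.span R {φ h h} * latIdx R F V (dualLat R F V φ L) L ≤
      Submodule.map (((2 : F) • (φ h)).restrictScalars R) L *
        Submodule.map (((2 : F) • (φ h)).restrictScalars R) L ∧
    APlusDualIdx R F ↥Wsub (LinearMap.BilinForm.restrict φ Wsub) (Submodule.comap ((Wsub.subtype).restrictScalars R) L) *
      ((Submodule.map (((2 : F) • (φ h)).restrictScalars R) L *
          Submodule.map (((2 : F) • (φ h)).restrictScalars R) L) *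
        (Submodule.map (((2 : F) • (φ h)).restrictScalars R) L *
          Submodule.map (((2 : F) • (φ h)).restrictScalars R) L)) =
      (Submodule.span R {φ h h} * latIdx R F V (dualLat R F V φ L) L) *
        (Submodule.span R {φ h h} * latIdx R F V (dualLat R F V φ L) L) := by
  subst hWsub
  have hR : ¬ IsField R := fun hR => NumberField.RingOfIntegers.not_isField F
    ((NumberField.RingOfIntegers.equiv R).toMulEquiv.isField hR)
  have : Module.Finite F V := Module.finite_of_finrank_pos (by omega)
  have hlat := hL.1
  have key := exists_locGen_discriminant hR hV hsymm hnd hq hlat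
  refine ⟨?_, ?_, ?_⟩
  · exact card_genus_eq_card_orderGenus hR (finrank_ker_flip hV hq) ⟨fun x y => hsymm.eq x y⟩
      (isLat_latInter hlat.1 _) (fun x hx => hlat.2 x hx)
      (halfDisc_perpQuad_ne_zero hsymm hnd hq)
  · refine le_of_forall_localAt_le hR fun v => ?_
    obtain ⟨b, D, hD, hb, hbD, -⟩ := key v
    exact hbD.localAt_le hD (hb.mul hb)
  · refine eq_of_forall_localAt_eq hR fun v => ?_
    obtain ⟨b, D, -, hb, hbD, hDD⟩ := key v
    have h1 := hDD.mul ((hb.mul hb).mul (hb.mul hb))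
    refine h1.localAt_eq ?_
    convert hbD.mul hbD using 1
    ring

end
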